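/- arXiv:2202.07821 — 2 statements merged into one kernel-verified Lean document; each statement's English description precedes it below -/
import Mathlib

section
/- (Convergence with exogenous step sizes.) Let f : S⁺_n → ℝ be geodesically convex and continuous, let X ⊆ S⁺_n be a nonempty compact geodesically convex set with diam(X) ≤ D for some D > 0, and let f* := inf_{p ∈ X} f(p). Let {p_k} be generated by the inexact projected subgradient iteration with p₀ ∈ X, v_k = s_k + u_k ≠ 0, s_k ∈ ∂f(p_k), and exogenous step sizes: t_k > 0, ∑_k t_k = ∞, ∑_k t_k² < ∞. Let ε > 0 and suppose there is k̄ such that ‖u_k‖_{p_k} ≤ ε for all k ≥ k̄. Then liminf_{k→∞} f(p_k) ≤ f* + εD. In particular, {p_k} has a cluster point p* ∈ X with f(p*) ≤ f* + εD. -/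
open Matrix Real Filter

namespace SPD

variable {n : ℕ}

/-- Apply a real function to a symmetric matrix via the spectral calculus
(junk value `0` on non-Hermitian input). -/
noncomputable def mfun (p : Matrix (Fin n) (Fin n) ℝ) (f : ℝ → ℝ) : Matrix (Fin n) (Fin n) ℝ :=
  if hp : p.IsHermitian then hp.cfc f else 0

/-- The positive definite square root. -/
noncomputable def msqrt (p : Matrix (Fin n) (Fin n) ℝ) : Matrix (Fin n) (Fin n) ℝ :=
  mfun p Real.sqrt

/-- The eigenvalues of a symmetric matrix (junk value `0` on non-Hermitian input). -/
noncomputable def eigs (p : Matrix (Fin n) (Fin n) ℝ) : Fin n → ℝ :=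
  if hp : p.IsHermitian then hp.eigenvalues else 0

/-- The Loewner order: `p ≤ q` iff `q - p` is positive semidefinite. -/
def Loewner (p q : Matrix (Fin n) (Fin n) ℝ) : Prop := (q - p).PosSemidef

/-- The Riemannian (trace-metric) distance on positive definite matrices:
`d(p,q) = (∑ i, (ln λ_i(p^{-1/2} q p^{-1/2}))²)^{1/2}`. -/
noncomputable def dR (p q : Matrix (Fin n) (Fin n) ℝ) : ℝ :=
  Real.sqrt (∑ i, (Real.log (eigs ((msqrt p)⁻¹ * q * (msqrt p)⁻¹) i)) ^ 2)

/-- The θ-weighted geometric mean `p #_θ q = p^{1/2} (p^{-1/2} q p^{-1/2})^θ p^{1/2}`. -/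
noncomputable def gmean (θ : ℝ) (p q : Matrix (Fin n) (Fin n) ℝ) : Matrix (Fin n) (Fin n) ℝ :=
  msqrt p * mfun ((msqrt p)⁻¹ * q * (msqrt p)⁻¹) (fun x => x ^ θ) * msqrt p

/-- The singular values of a matrix in decreasing order: `svals M i` is `α_{i+1}(M)`,
so `svals M ⟨0,_⟩ = α₁(M) ≥ … ≥ svals M ⟨n-1,_⟩ = α_n(M)`. -/
noncomputable def svals (M : Matrix (Fin n) (Fin n) ℝ) : Fin n → ℝ := fun i =>
  Real.sqrt ((eigs (Mᵀ * M) ∘ Tuple.sort (eigs (Mᵀ * M))) i.rev)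

/-- The operator (spectral) norm: the largest singular value. -/
noncomputable def opNorm (M : Matrix (Fin n) (Fin n) ℝ) : ℝ :=
  if h : 0 < n then svals M ⟨0, h⟩ else 0

/-- The trace-metric inner product `⟨u,v⟩_p = tr(p⁻¹ u p⁻¹ v)`. -/
noncomputable def minner (p u v : Matrix (Fin n) (Fin n) ℝ) : ℝ :=
  (p⁻¹ * u * p⁻¹ * v).trace

/-- The trace-metric norm `‖v‖_p`. -/
noncomputable def mnorm (p v : Matrix (Fin n) (Fin n) ℝ) : ℝ :=
  Real.sqrt (minner p v v)

/-- The Riemannian exponential `exp_p(v) = p^{1/2} exp(p^{-1/2} v p^{-1/2}) p^{1/2}`. -/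
noncomputable def mexpP (p v : Matrix (Fin n) (Fin n) ℝ) : Matrix (Fin n) (Fin n) ℝ :=
  msqrt p * mfun ((msqrt p)⁻¹ * v * (msqrt p)⁻¹) Real.exp * msqrt p

/-- The Riemannian logarithm `log_p(q) = p^{1/2} log(p^{-1/2} q p^{-1/2}) p^{1/2}`. -/
noncomputable def mlogP (p q : Matrix (Fin n) (Fin n) ℝ) : Matrix (Fin n) (Fin n) ℝ :=
  msqrt p * mfun ((msqrt p)⁻¹ * q * (msqrt p)⁻¹) Real.log * msqrt p

/-- `s` is a subgradient of `f` at `p`:  `f(q) ≥ f(p) + ⟨s, log_p q⟩_p` for all `q ∈ S⁺_n`. -/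
def IsSubgrad (f : Matrix (Fin n) (Fin n) ℝ → ℝ) (p s : Matrix (Fin n) (Fin n) ℝ) : Prop :=
  s.IsHermitian ∧ ∀ q : Matrix (Fin n) (Fin n) ℝ, q.PosDef → f p + minner p s (mlogP p q) ≤ f q

/-- Geodesic convexity of a function on `S⁺_n`. -/
def GConvexFun (f : Matrix (Fin n) (Fin n) ℝ → ℝ) : Prop :=
  ∀ p q : Matrix (Fin n) (Fin n) ℝ, p.PosDef → q.PosDef → ∀ θ ∈ Set.Icc (0:ℝ) 1,
    f (gmean θ p q) ≤ (1 - θ) * f p + θ * f q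

/-- Geodesic convexity of a subset of `S⁺_n`. -/
def GConvexSet (X : Set (Matrix (Fin n) (Fin n) ℝ)) : Prop :=
  ∀ p ∈ X, ∀ q ∈ X, ∀ θ ∈ Set.Icc (0:ℝ) 1, gmean θ p q ∈ X

/-- `κ̂ = 1/√2`, the square root of the absolute value of the curvature lower bound `-1/2`. -/
noncomputable def khat : ℝ := (Real.sqrt 2)⁻¹

/-- The inexact projected subgradient iteration: `p₀ ∈ X`; `v_k = s_k + u_k ≠ 0` with
`s_k ∈ ∂f(p_k)` and symmetric error `u_k`; `p̃_{k+1} = exp_{p_k}(−t_k·v_k/‖v_k‖_{p_k})`;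
and `p_{k+1} ∈ X` is a nearest point of `X` to `p̃_{k+1}` w.r.t. `d`. -/
structure Iter (f : Matrix (Fin n) (Fin n) ℝ → ℝ) (X : Set (Matrix (Fin n) (Fin n) ℝ))
    (p s u : ℕ → Matrix (Fin n) (Fin n) ℝ) (t : ℕ → ℝ) : Prop where
  p0_mem : p 0 ∈ X
  subgrad : ∀ k, IsSubgrad f (p k) (s k)
  u_herm : ∀ k, (u k).IsHermitian
  v_ne : ∀ k, s k + u k ≠ 0
  proj_mem : ∀ k, p (k + 1) ∈ X
  proj_nearest : ∀ k, ∀ q ∈ X,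
    dR (mexpP (p k) (-(t k / mnorm (p k) (s k + u k)) • (s k + u k))) (p (k + 1)) ≤
      dR (mexpP (p k) (-(t k / mnorm (p k) (s k + u k)) • (s k + u k))) q

end SPD

open SPD

namespace SPDaux

variable {n : ℕ}

lemma contOn (A : Matrix (Fin n) (Fin n) ℝ) (f : ℝ → ℝ) : ContinuousOn f (spectrum ℝ A) :=
  (Matrix.finite_real_spectrum (A := A)).continuousOn f

lemma contOn' (A : Matrix (Fin n) (Fin n) ℝ) (f g : ℝ → ℝ) :
    ContinuousOn f (g '' spectrum ℝ A) :=
  ((Matrix.finite_real_spectrum (A := A)).image g).continuousOn f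

lemma mfun_cfc {A : Matrix (Fin n) (Fin n) ℝ} (hA : A.IsHermitian) (f : ℝ → ℝ) :
    mfun A f = cfc f A := by
  rw [mfun, dif_pos hA, hA.cfc_eq]

lemma mfun_herm (A : Matrix (Fin n) (Fin n) ℝ) (f : ℝ → ℝ) : (mfun A f).IsHermitian := by
  by_cases hA : A.IsHermitian
  · rw [mfun_cfc hA]
    exact cfc_predicate (p := IsSelfAdjoint) f A
  · rw [mfun, dif_neg hA]; exact isHermitian_zero

lemma mfun_mul {A : Matrix (Fin n) (Fin n) ℝ} (hA : A.IsHermitian) (f g : ℝ → ℝ) :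
    mfun A f * mfun A g = mfun A (fun x => f x * g x) := by
  simp only [mfun_cfc hA]
  rw [cfc_mul f g A (contOn A f) (contOn A g)]

lemma mfun_sub {A : Matrix (Fin n) (Fin n) ℝ} (hA : A.IsHermitian) (f g : ℝ → ℝ) :
    mfun A f - mfun A g = mfun A (fun x => f x - g x) := by
  simp only [mfun_cfc hA]
  rw [cfc_sub f g A (contOn A f) (contOn A g)]

lemma mfun_smul {A : Matrix (Fin n) (Fin n) ℝ} (hA : A.IsHermitian) (r : ℝ) (f : ℝ → ℝ) :
    r • mfun A f = mfun A (fun x => r * f x) := by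
  simp only [mfun_cfc hA]
  rw [cfc_const_mul r f A (contOn A f)]

lemma mfun_one {A : Matrix (Fin n) (Fin n) ℝ} (hA : A.IsHermitian) :
    mfun A (fun _ => 1) = 1 := by
  simp only [mfun_cfc hA]
  exact cfc_const_one ℝ A hA

lemma mfun_id {A : Matrix (Fin n) (Fin n) ℝ} (hA : A.IsHermitian) :
    mfun A (fun x => x) = A := by
  simp only [mfun_cfc hA]
  exact cfc_id' ℝ A hA

lemma mfun_comp {A : Matrix (Fin n) (Fin n) ℝ} (hA : A.IsHermitian) (f g : ℝ → ℝ) :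
    mfun (mfun A f) g = mfun A (fun x => g (f x)) := by
  rw [mfun_cfc (mfun_herm A f), mfun_cfc hA, mfun_cfc hA]
  exact (cfc_comp' g f A (contOn' A g f) (contOn A f) hA).symm

lemma eigs_eq {A : Matrix (Fin n) (Fin n) ℝ} (hA : A.IsHermitian) : eigs A = hA.eigenvalues := by
  rw [eigs, dif_pos hA]

lemma mfun_congr {A : Matrix (Fin n) (Fin n) ℝ} {f g : ℝ → ℝ}
    (h : ∀ i, f (eigs A i) = g (eigs A i)) : mfun A f = mfun A g := by
  by_cases hA : A.IsHermitian
  · rw [mfun_cfc hA, mfun_cfc hA]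
    apply cfc_congr
    intro x hx
    rw [hA.spectrum_real_eq_range_eigenvalues] at hx
    obtain ⟨i, rfl⟩ := hx
    have := h i
    rwa [eigs_eq hA] at this
  · rw [mfun, mfun, dif_neg hA, dif_neg hA]

lemma eigs_pos {A : Matrix (Fin n) (Fin n) ℝ} (hA : A.PosDef) (i : Fin n) : 0 < eigs A i := by
  rw [eigs_eq hA.1]; exact hA.eigenvalues_pos i

lemma mfun_congr_pos {A : Matrix (Fin n) (Fin n) ℝ} (hA : A.PosDef) {f g : ℝ → ℝ}
    (h : ∀ x, 0 < x → f x = g x) : mfun A f = mfun A g :=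
  mfun_congr fun i => h _ (eigs_pos hA i)

/-- explicit spectral form -/
lemma mfun_spec {A : Matrix (Fin n) (Fin n) ℝ} (hA : A.IsHermitian) :
    ∃ U : Matrix (Fin n) (Fin n) ℝ, U * Uᵀ = 1 ∧ Uᵀ * U = 1 ∧
      ∀ f, mfun A f = U * diagonal (fun i => f (eigs A i)) * Uᵀ := by
  refine ⟨(hA.eigenvectorUnitary : Matrix (Fin n) (Fin n) ℝ), ?_, ?_, ?_⟩
  · have := Unitary.coe_mul_star_self hA.eigenvectorUnitary
    simpa [star_eq_conjTranspose] using this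
  · have := Unitary.coe_star_mul_self hA.eigenvectorUnitary
    simpa [star_eq_conjTranspose] using this
  · intro f
    rw [mfun, dif_pos hA, eigs_eq hA, IsHermitian.cfc, Unitary.conjStarAlgAut_apply]
    simp [star_eq_conjTranspose, Function.comp_def]

lemma trace_mfun {A : Matrix (Fin n) (Fin n) ℝ} (hA : A.IsHermitian) (f : ℝ → ℝ) :
    (mfun A f).trace = ∑ i, f (eigs A i) := by
  obtain ⟨U, h1, h2, h⟩ := mfun_spec hA
  rw [h, Matrix.trace_mul_cycle, h2, one_mul, trace_diagonal]

lemma trace_mfun_mul {A B : Matrix (Fin n) (Fin n) ℝ} (hA : A.IsHermitian) (hB : B.IsHermitian) :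
    ∃ P : Fin n → Fin n → ℝ, (∀ i j, 0 ≤ P i j) ∧ ∀ f g : ℝ → ℝ,
      (mfun A f * mfun B g).trace = ∑ i, ∑ j, P i j * (f (eigs A i) * g (eigs B j)) := by
  obtain ⟨U, h1, h2, h⟩ := mfun_spec hA
  obtain ⟨V, k1, k2, k⟩ := mfun_spec hB
  refine ⟨fun i j => ((Uᵀ * V) i j) ^ 2, fun i j => sq_nonneg _, fun f g => ?_⟩
  rw [h, k]
  have : (U * diagonal (fun i => f (eigs A i)) * Uᵀ * (V * diagonal (fun i => g (eigs B i)) * Vᵀ)).trace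
      = (diagonal (fun i => f (eigs A i)) * (Uᵀ * V) * diagonal (fun i => g (eigs B i)) * (Uᵀ * V)ᵀ).trace := by
    rw [transpose_mul, transpose_transpose]
    simp only [Matrix.mul_assoc]
    rw [Matrix.trace_mul_comm U]
    simp only [Matrix.mul_assoc]
  rw [this]
  simp only [Matrix.trace, Matrix.diag, Matrix.mul_apply (M := diagonal _ * (Uᵀ * V) * diagonal _),
    mul_diagonal, diagonal_mul, transpose_apply]
  refine Finset.sum_congr rfl fun i _ => Finset.sum_congr rfl fun j _ => ?_
  ring

/-- squared Frobenius norm -/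
def fsq (A : Matrix (Fin n) (Fin n) ℝ) : ℝ := ∑ i, ∑ j, A i j ^ 2

lemma fsq_nonneg (A : Matrix (Fin n) (Fin n) ℝ) : 0 ≤ fsq A :=
  Finset.sum_nonneg fun _ _ => Finset.sum_nonneg fun _ _ => sq_nonneg _

lemma fsq_eq (A : Matrix (Fin n) (Fin n) ℝ) : fsq A = (A * Aᵀ).trace := by
  simp [fsq, Matrix.trace, Matrix.mul_apply, sq]

lemma fsq_smul (r : ℝ) (A : Matrix (Fin n) (Fin n) ℝ) : fsq (r • A) = r ^ 2 * fsq A := by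
  simp [fsq, mul_pow, Finset.mul_sum]

lemma fsq_eq_zero {A : Matrix (Fin n) (Fin n) ℝ} (h : fsq A = 0) : A = 0 := by
  ext i j
  have h1 := (Finset.sum_eq_zero_iff_of_nonneg
    (fun i _ => Finset.sum_nonneg fun j _ => sq_nonneg (A i j))).1 h i (Finset.mem_univ _)
  have h2 := (Finset.sum_eq_zero_iff_of_nonneg (fun j _ => sq_nonneg (A i j))).1 h1 j
    (Finset.mem_univ _)
  simpa using h2

lemma fsq_transpose (A : Matrix (Fin n) (Fin n) ℝ) : fsq Aᵀ = fsq A := by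
  simp only [fsq, transpose_apply]; exact Finset.sum_comm

lemma fsq_mul_le (A B : Matrix (Fin n) (Fin n) ℝ) : fsq (A * B) ≤ fsq A * fsq B := by
  rw [← fsq_transpose B]
  simp only [fsq, Matrix.mul_apply, transpose_apply]
  rw [Finset.sum_mul_sum]
  exact Finset.sum_le_sum fun i _ => Finset.sum_le_sum fun j _ =>
    Finset.sum_mul_sq_le_sq_mul_sq _ _ _

lemma trace_mul_sq_le (A B : Matrix (Fin n) (Fin n) ℝ) : (A * B).trace ^ 2 ≤ fsq A * fsq B := by
  rw [← fsq_transpose B]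
  simp only [fsq, Matrix.trace, Matrix.diag, Matrix.mul_apply, transpose_apply]
  simp only [← Finset.sum_product']
  exact Finset.sum_mul_sq_le_sq_mul_sq _ (fun x : Fin n × Fin n => A x.1 x.2) (fun x => B x.2 x.1)

lemma abs_trace_mul_le (A B : Matrix (Fin n) (Fin n) ℝ) :
    |(A * B).trace| ≤ √(fsq A) * √(fsq B) := by
  rw [← Real.sqrt_mul (fsq_nonneg A)]
  exact Real.abs_le_sqrt (trace_mul_sq_le A B)

lemma fsq_add_le (A B : Matrix (Fin n) (Fin n) ℝ) : fsq (A + B) ≤ 2 * fsq A + 2 * fsq B := by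
  simp only [fsq, Finset.mul_sum, ← Finset.sum_add_distrib]
  refine Finset.sum_le_sum fun i _ => Finset.sum_le_sum fun j _ => ?_
  simp only [Matrix.add_apply]
  nlinarith [sq_nonneg (A i j - B i j)]

lemma herm_transpose {A : Matrix (Fin n) (Fin n) ℝ} (hA : A.IsHermitian) : Aᵀ = A := by
  simpa [IsHermitian] using hA

lemma fsq_mfun {A : Matrix (Fin n) (Fin n) ℝ} (hA : A.IsHermitian) (f : ℝ → ℝ) :
    fsq (mfun A f) = ∑ i, f (eigs A i) ^ 2 := by
  rw [fsq_eq, herm_transpose (mfun_herm A f), mfun_mul hA, trace_mfun hA]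
  simp [sq]

lemma fsq_herm {A : Matrix (Fin n) (Fin n) ℝ} (hA : A.IsHermitian) :
    fsq A = ∑ i, eigs A i ^ 2 := by
  have := fsq_mfun hA (fun x => x)
  rwa [mfun_id hA] at this

/-- Klein type inequality -/
lemma klein {A B : Matrix (Fin n) (Fin n) ℝ} (hA : A.IsHermitian) (hB : B.IsHermitian)
    (g g' : ℝ → ℝ) (C : ℝ)
    (h : ∀ i j, |g (eigs B j) - g (eigs A i) - g' (eigs A i) * (eigs B j - eigs A i)|
      ≤ C * (eigs B j - eigs A i) ^ 2) :
    |(mfun B g).trace - (mfun A g).trace - (mfun A g' * (B - A)).trace| ≤ C * fsq (B - A) := by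
  obtain ⟨P, hP, hT⟩ := trace_mfun_mul hA hB
  have e1 := hT (fun _ => 1) g
  have e2 := hT g (fun _ => 1)
  have e3 := hT g' (fun x => x)
  have e4 := hT (fun x => g' x * x) (fun _ => 1)
  have e5 := hT (fun _ => 1) (fun x => x * x)
  have e6 := hT (fun x => x) (fun x => x)
  have e7 := hT (fun x => x * x) (fun _ => 1)
  rw [← mfun_mul hA] at e4 e7
  rw [← mfun_mul hB] at e5
  rw [mfun_one hA, one_mul] at e1 e5
  rw [mfun_one hB, mul_one] at e2 e4 e7
  simp only [mfun_id hA, mfun_id hB] at e3 e4 e5 e6 e7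
  have f1 : fsq (B - A) = ∑ i, ∑ j, P i j * (eigs B j - eigs A i) ^ 2 := by
    rw [fsq_eq, herm_transpose (hB.sub hA), Matrix.sub_mul, Matrix.mul_sub, Matrix.mul_sub,
      Matrix.trace_sub, Matrix.trace_sub, Matrix.trace_sub, Matrix.trace_mul_comm B A, e5, e6, e7]
    simp only [← Finset.sum_sub_distrib]
    refine Finset.sum_congr rfl fun i _ => Finset.sum_congr rfl fun j _ => ?_
    ring
  have f2 : (mfun B g).trace - (mfun A g).trace - (mfun A g' * (B - A)).trace =
      ∑ i, ∑ j, P i j * (g (eigs B j) - g (eigs A i) - g' (eigs A i) * (eigs B j - eigs A i)) := by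
    rw [Matrix.mul_sub, Matrix.trace_sub, e1, e2, e3, e4]
    simp only [← Finset.sum_sub_distrib]
    refine Finset.sum_congr rfl fun i _ => Finset.sum_congr rfl fun j _ => ?_
    ring
  rw [f1, f2, Finset.mul_sum]
  refine (Finset.abs_sum_le_sum_abs _ _).trans (Finset.sum_le_sum fun i _ => ?_)
  rw [Finset.mul_sum]
  refine (Finset.abs_sum_le_sum_abs _ _).trans (Finset.sum_le_sum fun j _ => ?_)
  rw [abs_mul, abs_of_nonneg (hP i j)]
  nlinarith [mul_le_mul_of_nonneg_left (h i j) (hP i j)]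

/-- intertwining -/
lemma mfun_intertwine {A B S : Matrix (Fin n) (Fin n) ℝ} (hA : A.IsHermitian) (hB : B.IsHermitian)
    (h : S * A = B * S) (f : ℝ → ℝ) : S * mfun A f = mfun B f * S := by
  obtain ⟨U, h1, h2, hU⟩ := mfun_spec hA
  obtain ⟨V, k1, k2, hV⟩ := mfun_spec hB
  have hA' := hU (fun x => x)
  have hB' := hV (fun x => x)
  rw [mfun_id hA] at hA'
  rw [mfun_id hB] at hB'
  have key : (Vᵀ * S * U) * diagonal (fun i => eigs A i) = diagonal (fun i => eigs B i) * (Vᵀ * S * U) := by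
    calc (Vᵀ * S * U) * diagonal (fun i => eigs A i)
        = Vᵀ * (S * (U * diagonal (fun i => eigs A i) * Uᵀ)) * U := by
          simp only [Matrix.mul_assoc, h2, Matrix.mul_one]
      _ = Vᵀ * ((V * diagonal (fun i => eigs B i) * Vᵀ) * S) * U := by
          rw [← hA', ← hB', h]
      _ = (Vᵀ * V) * diagonal (fun i => eigs B i) * (Vᵀ * S * U) := by
          simp only [Matrix.mul_assoc]
      _ = _ := by rw [k2, Matrix.one_mul]
  have key2 : (Vᵀ * S * U) * diagonal (fun i => f (eigs A i))
      = diagonal (fun i => f (eigs B i)) * (Vᵀ * S * U) := by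
    ext i j
    have := congrFun (congrFun key i) j
    rw [mul_diagonal, diagonal_mul] at this
    rw [mul_diagonal, diagonal_mul]
    by_cases hz : (Vᵀ * S * U) i j = 0
    · simp [hz]
    · have : eigs A j = eigs B i := by
        rw [mul_comm] at this
        exact mul_right_cancel₀ hz this
      rw [this, mul_comm]
  rw [hU, hV]
  calc S * (U * diagonal (fun i => f (eigs A i)) * Uᵀ)
      = (V * Vᵀ) * S * (U * diagonal (fun i => f (eigs A i)) * Uᵀ) := by rw [k1, Matrix.one_mul]
    _ = V * ((Vᵀ * S * U) * diagonal (fun i => f (eigs A i))) * Uᵀ := by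
        simp only [Matrix.mul_assoc]
    _ = V * diagonal (fun i => f (eigs B i)) * Vᵀ * S * (U * Uᵀ) := by
        rw [key2]; simp only [Matrix.mul_assoc]
    _ = _ := by rw [h1, Matrix.mul_one]

end SPDaux

namespace SPDaux

variable {n : ℕ}

lemma isUnit_of_mul {U V : Matrix (Fin n) (Fin n) ℝ} (h : U * V = 1) : IsUnit U :=
  (Matrix.isUnit_iff_isUnit_det U).2 (Matrix.isUnit_det_of_right_inverse h)

lemma posDef_cong {A S : Matrix (Fin n) (Fin n) ℝ} (hA : A.PosDef) (hS : IsUnit S) :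
    (S * A * Sᵀ).PosDef := by
  have := hA.mul_mul_conjTranspose_same (Matrix.vecMul_injective_of_isUnit hS)
  simpa using this

lemma posSemidef_cong {A : Matrix (Fin n) (Fin n) ℝ} (hA : A.PosSemidef)
    (S : Matrix (Fin n) (Fin n) ℝ) : (S * A * Sᵀ).PosSemidef := by
  have := hA.mul_mul_conjTranspose_same S
  simpa using this

lemma mfun_posDef {A : Matrix (Fin n) (Fin n) ℝ} (hA : A.IsHermitian) {f : ℝ → ℝ}
    (h : ∀ i, 0 < f (eigs A i)) : (mfun A f).PosDef := by
  obtain ⟨U, h1, h2, hU⟩ := mfun_spec hA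
  rw [hU]
  exact posDef_cong (posDef_diagonal_iff.2 h) (isUnit_of_mul h1)

lemma mfun_posSemidef {A : Matrix (Fin n) (Fin n) ℝ} (hA : A.IsHermitian) {f : ℝ → ℝ}
    (h : ∀ i, 0 ≤ f (eigs A i)) : (mfun A f).PosSemidef := by
  obtain ⟨U, h1, h2, hU⟩ := mfun_spec hA
  rw [hU]
  exact posSemidef_cong (posSemidef_diagonal_iff.2 h) _

lemma smul_one_eq {A : Matrix (Fin n) (Fin n) ℝ} (hA : A.IsHermitian) (c : ℝ) :
    c • (1 : Matrix (Fin n) (Fin n) ℝ) = mfun A (fun _ => c) := by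
  rw [← mfun_one hA, mfun_smul hA]; simp

/-- eigenvalue lower bound to Loewner bound -/
lemma loewner_of_eigs {A : Matrix (Fin n) (Fin n) ℝ} (hA : A.IsHermitian) {f : ℝ → ℝ} {c : ℝ}
    (h : ∀ i, c ≤ f (eigs A i)) : (mfun A f - c • (1 : Matrix (Fin n) (Fin n) ℝ)).PosSemidef := by
  rw [smul_one_eq hA, mfun_sub hA]
  exact mfun_posSemidef hA fun i => sub_nonneg.2 (h i)

lemma eigs_of_loewner {A : Matrix (Fin n) (Fin n) ℝ} (hA : A.IsHermitian) {c : ℝ}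
    (h : (A - c • (1 : Matrix (Fin n) (Fin n) ℝ)).PosSemidef) (i : Fin n) : c ≤ eigs A i := by
  obtain ⟨U, h1, h2, hU⟩ := mfun_spec hA
  have e : A - c • (1 : Matrix (Fin n) (Fin n) ℝ) = mfun A (fun x => x - c) := by
    rw [smul_one_eq hA, ← mfun_sub hA, mfun_id hA]
  have := posSemidef_cong h Uᵀ
  rw [e, hU, transpose_transpose] at this
  have e2 : Uᵀ * (U * diagonal (fun i => eigs A i - c) * Uᵀ) * U
      = diagonal (fun i => eigs A i - c) := by
    calc _ = (Uᵀ * U) * diagonal (fun i => eigs A i - c) * (Uᵀ * U) := by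
            simp only [Matrix.mul_assoc]
      _ = _ := by rw [h2, Matrix.one_mul, Matrix.mul_one]
  rw [e2, posSemidef_diagonal_iff] at this
  exact sub_nonneg.1 (this i)

lemma msqrt_posDef {q : Matrix (Fin n) (Fin n) ℝ} (hq : q.PosDef) : (msqrt q).PosDef :=
  mfun_posDef hq.1 fun i => Real.sqrt_pos.2 (eigs_pos hq i)

lemma msqrt_mul {q : Matrix (Fin n) (Fin n) ℝ} (hq : q.PosDef) : msqrt q * msqrt q = q := by
  rw [msqrt, mfun_mul hq.1]
  conv_rhs => rw [← mfun_id hq.1]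
  exact mfun_congr_pos hq fun x hx => Real.mul_self_sqrt hx.le

lemma msqrt_mul_inv {q : Matrix (Fin n) (Fin n) ℝ} (hq : q.PosDef) : msqrt q * (msqrt q)⁻¹ = 1 :=
  Matrix.mul_nonsing_inv _ ((Matrix.isUnit_iff_isUnit_det _).1 (msqrt_posDef hq).isUnit)

lemma msqrt_inv_mul {q : Matrix (Fin n) (Fin n) ℝ} (hq : q.PosDef) : (msqrt q)⁻¹ * msqrt q = 1 :=
  Matrix.nonsing_inv_mul _ ((Matrix.isUnit_iff_isUnit_det _).1 (msqrt_posDef hq).isUnit)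

lemma msqrt_tr (q : Matrix (Fin n) (Fin n) ℝ) : (msqrt q)ᵀ = msqrt q :=
  herm_transpose (mfun_herm _ _)

lemma msqrt_inv_tr (q : Matrix (Fin n) (Fin n) ℝ) : ((msqrt q)⁻¹)ᵀ = (msqrt q)⁻¹ := by
  rw [Matrix.transpose_nonsing_inv, msqrt_tr]

/-- `q^{-1/2} x q^{-1/2}` -/
noncomputable def cg (q x : Matrix (Fin n) (Fin n) ℝ) : Matrix (Fin n) (Fin n) ℝ :=
  (msqrt q)⁻¹ * x * (msqrt q)⁻¹

lemma cg_herm {x : Matrix (Fin n) (Fin n) ℝ} (q) (hx : x.IsHermitian) : (cg q x).IsHermitian := by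
  rw [IsHermitian, conjTranspose_eq_transpose_of_trivial, cg, transpose_mul, transpose_mul,
    msqrt_inv_tr, herm_transpose hx, Matrix.mul_assoc]

lemma cg_posDef {q x : Matrix (Fin n) (Fin n) ℝ} (hq : q.PosDef) (hx : x.PosDef) :
    (cg q x).PosDef := by
  have := posDef_cong hx (isUnit_of_mul (msqrt_inv_mul hq))
  rwa [msqrt_inv_tr] at this

noncomputable def ell (q x : Matrix (Fin n) (Fin n) ℝ) : Matrix (Fin n) (Fin n) ℝ :=
  mfun (cg q x) Real.log

/-- `q^{1/2} e^L q^{1/2}` -/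
noncomputable def ex (q L : Matrix (Fin n) (Fin n) ℝ) : Matrix (Fin n) (Fin n) ℝ :=
  msqrt q * mfun L Real.exp * msqrt q

lemma ell_herm (q x : Matrix (Fin n) (Fin n) ℝ) : (ell q x).IsHermitian := mfun_herm _ _

lemma ex_posDef {q L : Matrix (Fin n) (Fin n) ℝ} (hq : q.PosDef) (hL : L.IsHermitian) :
    (ex q L).PosDef := by
  have := posDef_cong (mfun_posDef hL (f := Real.exp) fun i => Real.exp_pos _)
    (msqrt_posDef hq).isUnit
  rwa [msqrt_tr] at this

lemma cg_conj {q : Matrix (Fin n) (Fin n) ℝ} (hq : q.PosDef) (M : Matrix (Fin n) (Fin n) ℝ) :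
    cg q (msqrt q * M * msqrt q) = M := by
  calc cg q (msqrt q * M * msqrt q)
      = ((msqrt q)⁻¹ * msqrt q) * M * (msqrt q * (msqrt q)⁻¹) := by
        simp only [cg, Matrix.mul_assoc]
    _ = M := by rw [msqrt_inv_mul hq, msqrt_mul_inv hq, Matrix.one_mul, Matrix.mul_one]

lemma conj_cg {q : Matrix (Fin n) (Fin n) ℝ} (hq : q.PosDef) (M : Matrix (Fin n) (Fin n) ℝ) :
    msqrt q * cg q M * msqrt q = M := by
  calc msqrt q * cg q M * msqrt q
      = (msqrt q * (msqrt q)⁻¹) * M * ((msqrt q)⁻¹ * msqrt q) := by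
        simp only [cg, Matrix.mul_assoc]
    _ = M := by rw [msqrt_inv_mul hq, msqrt_mul_inv hq, Matrix.one_mul, Matrix.mul_one]

lemma ell_ex {q L : Matrix (Fin n) (Fin n) ℝ} (hq : q.PosDef) (hL : L.IsHermitian) :
    ell q (ex q L) = L := by
  rw [ell, ex, cg_conj hq, mfun_comp hL]
  simp only [Real.log_exp]
  exact mfun_id hL

lemma ex_ell {q x : Matrix (Fin n) (Fin n) ℝ} (hq : q.PosDef) (hx : x.PosDef) :
    ex q (ell q x) = x := by
  rw [ex, ell, mfun_comp (cg_herm q hx.1)]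
  rw [mfun_congr_pos (cg_posDef hq hx) (g := fun x => x) fun y hy => Real.exp_log hy,
    mfun_id (cg_herm q hx.1), conj_cg hq]

lemma gmean_eq {q x : Matrix (Fin n) (Fin n) ℝ} (hq : q.PosDef) (hx : x.PosDef) (θ : ℝ) :
    gmean θ q x = ex q (θ • ell q x) := by
  rw [gmean, ex, ell, mfun_smul (cg_herm q hx.1), mfun_comp (cg_herm q hx.1)]
  congr 2
  refine mfun_congr_pos (cg_posDef hq hx) fun y hy => ?_
  rw [Real.rpow_def_of_pos hy, mul_comm]

lemma mexpP_eq (q v : Matrix (Fin n) (Fin n) ℝ) : mexpP q v = ex q (cg q v) := rfl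

lemma fsq_ell {q x : Matrix (Fin n) (Fin n) ℝ} (hx : x.PosDef) :
    fsq (ell q x) = ∑ i, Real.log (eigs (cg q x) i) ^ 2 := by
  rw [ell, fsq_mfun (cg_herm q hx.1)]

lemma dR_eq {q x : Matrix (Fin n) (Fin n) ℝ} (hx : x.PosDef) :
    dR q x = √(fsq (ell q x)) := by
  rw [fsq_ell hx]; rfl

lemma dR_sq {q x : Matrix (Fin n) (Fin n) ℝ} (hx : x.PosDef) :
    dR q x ^ 2 = fsq (ell q x) := by
  rw [dR_eq hx, Real.sq_sqrt (fsq_nonneg _)]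

lemma dR_sq_trace {q x : Matrix (Fin n) (Fin n) ℝ} (hx : x.PosDef) :
    dR q x ^ 2 = (mfun (cg q x) (fun y => Real.log y ^ 2)).trace := by
  rw [dR_sq hx, fsq_ell hx, trace_mfun (cg_herm q hx.1)]

lemma mfun_inv {A : Matrix (Fin n) (Fin n) ℝ} (hA : A.PosDef) (f : ℝ → ℝ) :
    mfun A⁻¹ f = mfun A (fun x => f x⁻¹) := by
  have : A⁻¹ = mfun A (fun x => x⁻¹) := by
    apply Matrix.inv_eq_right_inv
    conv_lhs => lhs; rw [← mfun_id hA.1]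
    rw [mfun_mul hA.1, mfun_congr_pos hA (g := fun _ => 1), mfun_one hA.1]
    intro x hx
    exact mul_inv_cancel₀ hx.ne'
  rw [this, mfun_comp hA.1]

/-- `K = x^{-1/2} q^{1/2}` -/
noncomputable def KK (x q : Matrix (Fin n) (Fin n) ℝ) : Matrix (Fin n) (Fin n) ℝ :=
  (msqrt x)⁻¹ * msqrt q

lemma KK_tr (x q : Matrix (Fin n) (Fin n) ℝ) : (KK x q)ᵀ = msqrt q * (msqrt x)⁻¹ := by
  rw [KK, transpose_mul, msqrt_tr, msqrt_inv_tr]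

lemma KK_mul_tr (x) {q : Matrix (Fin n) (Fin n) ℝ} (hq : q.PosDef) :
    KK x q * (KK x q)ᵀ = cg x q := by
  calc KK x q * (KK x q)ᵀ = (msqrt x)⁻¹ * (msqrt q * msqrt q) * (msqrt x)⁻¹ := by
        rw [KK_tr, KK]; simp only [Matrix.mul_assoc]
    _ = _ := by rw [msqrt_mul hq, cg]

lemma KK_tr_mul {x q : Matrix (Fin n) (Fin n) ℝ} (hx : x.PosDef) (hq : q.PosDef) :
    (KK x q)ᵀ * KK x q = (cg q x)⁻¹ := by
  symm
  apply Matrix.inv_eq_right_inv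
  rw [KK_tr, KK]
  calc cg q x * (msqrt q * (msqrt x)⁻¹ * ((msqrt x)⁻¹ * msqrt q))
      = (msqrt q)⁻¹ * x * ((msqrt q)⁻¹ * msqrt q) * (msqrt x)⁻¹ * ((msqrt x)⁻¹ * msqrt q) := by
        simp only [cg, Matrix.mul_assoc]
    _ = (msqrt q)⁻¹ * (msqrt x * msqrt x) * (msqrt x)⁻¹ * ((msqrt x)⁻¹ * msqrt q) := by
        rw [msqrt_inv_mul hq, Matrix.mul_one, msqrt_mul hx]
    _ = (msqrt q)⁻¹ * (msqrt x * (msqrt x * (msqrt x)⁻¹) * (msqrt x)⁻¹) * msqrt q := by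
        simp only [Matrix.mul_assoc]
    _ = 1 := by rw [msqrt_mul_inv hx, Matrix.mul_one, msqrt_mul_inv hx, Matrix.mul_one,
                  msqrt_inv_mul hq]

lemma KK_unit {x q : Matrix (Fin n) (Fin n) ℝ} (hx : x.PosDef) (hq : q.PosDef) :
    IsUnit (KK x q) := by
  have h1 := isUnit_of_mul (msqrt_inv_mul hx)
  exact h1.mul (msqrt_posDef hq).isUnit

/-- `K f((cg q x)⁻¹) = f(cg x q) K` -/
lemma KK_intertwine {x q : Matrix (Fin n) (Fin n) ℝ} (hx : x.PosDef) (hq : q.PosDef)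
    (f : ℝ → ℝ) :
    KK x q * mfun (cg q x) (fun y => f y⁻¹) = mfun (cg x q) f * KK x q := by
  rw [← mfun_inv (cg_posDef hq hx)]
  apply mfun_intertwine (cg_posDef hq hx).inv.1 (cg_herm x hq.1)
  rw [← KK_mul_tr x hq, ← KK_tr_mul hx hq, Matrix.mul_assoc]

lemma dR_symm {x q : Matrix (Fin n) (Fin n) ℝ} (hx : x.PosDef) (hq : q.PosDef) :
    dR x q = dR q x := by
  have h : dR x q ^ 2 = dR q x ^ 2 := by
    rw [dR_sq_trace hq, dR_sq_trace hx]
    have h1 := KK_intertwine hx hq (fun y => Real.log y ^ 2)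
    have hd := (Matrix.isUnit_iff_isUnit_det _).1 (KK_unit hx hq)
    have h2 : mfun (cg x q) (fun y => Real.log y ^ 2) =
        KK x q * mfun (cg q x) (fun y => Real.log y⁻¹ ^ 2) * (KK x q)⁻¹ := by
      rw [h1, Matrix.mul_assoc, Matrix.mul_nonsing_inv _ hd, Matrix.mul_one]
    rw [h2, Matrix.trace_mul_cycle, Matrix.nonsing_inv_mul _ hd, Matrix.one_mul]
    simp
  have a : 0 ≤ dR x q := Real.sqrt_nonneg _
  have b : 0 ≤ dR q x := Real.sqrt_nonneg _
  exact (pow_left_inj₀ a b two_ne_zero).1 h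

/-- scalar second order estimate for `log²`. -/
lemma scalar_est (m M : ℝ) (hm : 0 < m) (hM : 0 < M) : ∃ C, 0 ≤ C ∧ ∀ a b : ℝ, m ≤ a → a ≤ M →
    |Real.log a| ≤ M → m ≤ b →
    |Real.log b ^ 2 - Real.log a ^ 2 - (2 * Real.log a / a) * (b - a)| ≤ C * (b - a) ^ 2 := by
  refine ⟨(1 + (M / m) ^ 2 + 2 * M * (M / m)) / m ^ 2, by positivity, fun a b ha haM hla hb => ?_⟩
  have ha0 : 0 < a := hm.trans_le ha
  have hb0 : 0 < b := hm.trans_le hb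
  obtain ⟨r, hr⟩ : ∃ r, r = b / a := ⟨_, rfl⟩
  have hr0 : 0 < r := by rw [hr]; positivity
  have hbr : b = a * r := by rw [hr]; field_simp
  have hri : r⁻¹ ≤ M / m := by
    rw [hr, inv_div]; gcongr
  have e : Real.log b ^ 2 - Real.log a ^ 2 - (2 * Real.log a / a) * (b - a)
      = Real.log r ^ 2 + 2 * Real.log a * (Real.log r - (r - 1)) := by
    rw [hbr, Real.log_mul ha0.ne' hr0.ne']; field_simp; ring
  have l1 := Real.log_le_sub_one_of_pos hr0
  have l2 := Real.one_sub_inv_le_log_of_pos hr0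
  have hrr : r * r⁻¹ = 1 := mul_inv_cancel₀ hr0.ne'
  have hi0 : 0 < r⁻¹ := by positivity
  set i := r⁻¹ with hi
  have k1 : Real.log r ^ 2 ≤ (r - 1) ^ 2 * (1 + i ^ 2) := by
    have : (r - 1) ^ 2 * (1 + i ^ 2) = (r - 1) ^ 2 + (1 - i) ^ 2 := by
      have : (r - 1) * i = 1 - i := by linear_combination hrr
      rw [← this]; ring
    rw [this]
    rcases le_total 0 (Real.log r) with h | h
    · nlinarith [sq_nonneg (1 - i)]
    · nlinarith [sq_nonneg (r - 1)]
  have k2 : |Real.log r - (r - 1)| ≤ (r - 1) ^ 2 * i := by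
    rw [abs_of_nonpos (by linarith)]
    have : (r - 1) ^ 2 * i = r - 2 + i := by linear_combination (r - 2) * hrr
    rw [this]; linarith
  have hb2 : (r - 1) ^ 2 = (b - a) ^ 2 / a ^ 2 := by
    rw [hr]; field_simp
  have hb3 : (r - 1) ^ 2 ≤ (b - a) ^ 2 / m ^ 2 := by
    rw [hb2]; gcongr
  rw [e]
  calc |Real.log r ^ 2 + 2 * Real.log a * (Real.log r - (r - 1))|
      ≤ |Real.log r ^ 2| + |2 * Real.log a * (Real.log r - (r - 1))| := abs_add_le _ _
    _ = Real.log r ^ 2 + 2 * |Real.log a| * |Real.log r - (r - 1)| := by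
        rw [abs_of_nonneg (sq_nonneg _), abs_mul, abs_mul, abs_two]
    _ ≤ (r - 1) ^ 2 * (1 + i ^ 2) + 2 * M * ((r - 1) ^ 2 * i) := by gcongr
    _ = (1 + i ^ 2 + 2 * M * i) * (r - 1) ^ 2 := by ring
    _ ≤ (1 + (M / m) ^ 2 + 2 * M * (M / m)) * ((b - a) ^ 2 / m ^ 2) := by gcongr
    _ = _ := by ring

end SPDaux

namespace SPDaux

variable {n : ℕ}

lemma abs_eigs_le {L : Matrix (Fin n) (Fin n) ℝ} (hL : L.IsHermitian) (h : fsq L ≤ 1) (i : Fin n) :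
    |eigs L i| ≤ 1 := by
  rw [fsq_herm hL] at h
  have := Finset.single_le_sum (f := fun i => eigs L i ^ 2) (fun i _ => sq_nonneg _)
    (Finset.mem_univ i)
  exact (sq_le_one_iff_abs_le_one _).1 (this.trans h)

lemma abs_log_eigs_le {x q : Matrix (Fin n) (Fin n) ℝ} {D : ℝ}
    (h : dR x q ≤ D) (i : Fin n) : |Real.log (eigs (cg x q) i)| ≤ D := by
  refine le_trans ?_ h
  apply Real.abs_le_sqrt
  exact Finset.single_le_sum (f := fun i => Real.log (eigs (cg x q) i) ^ 2)
    (fun i _ => sq_nonneg _) (Finset.mem_univ i)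

lemma cg_ex (x q L : Matrix (Fin n) (Fin n) ℝ) :
    cg x (ex q L) = KK x q * mfun L Real.exp * (KK x q)ᵀ := by
  rw [KK_tr, KK, cg, ex]; simp only [Matrix.mul_assoc]

lemma fsq_exp_sub_one {L : Matrix (Fin n) (Fin n) ℝ} (hL : L.IsHermitian) (h : fsq L ≤ 1) :
    fsq (mfun L Real.exp - 1) ≤ 4 * fsq L := by
  rw [← mfun_one hL, mfun_sub hL, fsq_mfun hL, fsq_herm hL, Finset.mul_sum]
  refine Finset.sum_le_sum fun i _ => ?_
  have := Real.abs_exp_sub_one_le (abs_eigs_le hL h i)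
  calc (Real.exp (eigs L i) - 1) ^ 2 = |Real.exp (eigs L i) - 1| ^ 2 := (sq_abs _).symm
    _ ≤ (2 * |eigs L i|) ^ 2 := by gcongr
    _ = _ := by rw [mul_pow, sq_abs]; norm_num

lemma fsq_exp_sub_one_sub {L : Matrix (Fin n) (Fin n) ℝ} (hL : L.IsHermitian) (h : fsq L ≤ 1) :
    fsq (mfun L Real.exp - 1 - L) ≤ fsq L ^ 2 := by
  have e : mfun L Real.exp - 1 - L = mfun L (fun x => Real.exp x - 1 - x) := by
    rw [← mfun_sub hL (fun x => Real.exp x - 1) (fun x => x), ← mfun_sub hL, mfun_one hL, mfun_id hL]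
  rw [e, fsq_mfun hL, fsq_herm hL]
  refine le_trans (Finset.sum_le_sum (g := fun i => (eigs L i ^ 2) ^ 2) fun i _ => ?_) ?_
  · have := Real.abs_exp_sub_one_sub_id_le (abs_eigs_le hL h i)
    rw [← sq_abs]
    gcongr
  · exact Finset.sum_sq_le_sq_sum_of_nonneg fun i _ => sq_nonneg _

lemma fsq_KK {x q : Matrix (Fin n) (Fin n) ℝ} (hq : q.PosDef) {M : ℝ}
    (h : ∀ i, eigs (cg x q) i ≤ M) : fsq (KK x q) ≤ n * M := by
  rw [fsq_eq, KK_mul_tr x hq, ← mfun_id (cg_herm x hq.1), trace_mfun (cg_herm x hq.1)]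
  refine (Finset.sum_le_sum fun i _ => h i).trans ?_
  simp

/-- second-order expansion of squared distance -/
lemma expand (D : ℝ) (hD : 0 ≤ D) : ∃ C, 0 ≤ C ∧ ∀ x q L : Matrix (Fin n) (Fin n) ℝ,
    x.PosDef → q.PosDef → L.IsHermitian → fsq L ≤ 1 → dR x q ≤ D →
    |dR x (ex q L) ^ 2 - dR x q ^ 2 + 2 * (ell q x * L).trace| ≤ C * fsq L := by
  obtain ⟨C1, hC1, hest⟩ := scalar_est (Real.exp (-1) * Real.exp (-D)) (Real.exp D)
    (by positivity) (by positivity)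
  refine ⟨C1 * ((n * Real.exp D) ^ 2 * 4) + 2 * D, by positivity, fun x q L hx hq hL hL1 hd => ?_⟩
  have hz := ex_posDef hq hL
  have hA := cg_herm x hq.1
  have hB := cg_herm x hz.1
  have hApos := cg_posDef hx hq
  -- eigenvalue bounds
  have ea : ∀ i, Real.exp (-D) ≤ eigs (cg x q) i ∧ eigs (cg x q) i ≤ Real.exp D := by
    intro i
    have h1 := abs_le.1 (abs_log_eigs_le hd i)
    have h2 := eigs_pos hApos i
    exact ⟨(Real.le_log_iff_exp_le h2).1 h1.1, (Real.log_le_iff_le_exp h2).1 h1.2⟩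
  have eb : ∀ i, Real.exp (-1) * Real.exp (-D) ≤ eigs (cg x (ex q L)) i := by
    apply eigs_of_loewner hB
    have p1 : (mfun L Real.exp - Real.exp (-1) • (1 : Matrix (Fin n) (Fin n) ℝ)).PosSemidef :=
      loewner_of_eigs hL fun i => Real.exp_le_exp.2 (abs_le.1 (abs_eigs_le hL hL1 i)).1
    have p2 := posSemidef_cong p1 (KK x q)
    have p3 : (cg x q - Real.exp (-D) • (1 : Matrix (Fin n) (Fin n) ℝ)).PosSemidef := by
      have := loewner_of_eigs hA (f := fun x => x) fun i => (ea i).1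
      rwa [mfun_id hA] at this
    have p4 := p2.add (p3.smul (Real.exp_pos (-1)).le)
    convert p4 using 1
    rw [cg_ex, Matrix.mul_sub, Matrix.sub_mul, Matrix.mul_smul, Matrix.mul_one, Matrix.smul_mul,
      KK_mul_tr x hq, smul_sub, smul_smul]
    abel
  have hk := klein hA hB (fun y => Real.log y ^ 2) (fun y => 2 * Real.log y / y) C1 (by
    intro i j
    apply hest
    · refine le_trans ?_ (ea i).1
      have : Real.exp (-1) ≤ 1 := Real.exp_le_one_iff.2 (by norm_num)
      nlinarith [Real.exp_pos (-D)]
    · exact (ea i).2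
    · refine (abs_log_eigs_le hd i).trans ?_
      linarith [Real.add_one_le_exp D]
    · exact eb j)
  rw [← dR_sq_trace hz, ← dR_sq_trace hq] at hk
  have hBA : cg x (ex q L) - cg x q = KK x q * (mfun L Real.exp - 1) * (KK x q)ᵀ := by
    rw [cg_ex, Matrix.mul_sub, Matrix.sub_mul, Matrix.mul_one, KK_mul_tr x hq]
  have hf : fsq (cg x (ex q L) - cg x q) ≤ (n * Real.exp D) ^ 2 * 4 * fsq L := by
    have hK := fsq_KK hq (fun i => (ea i).2)
    rw [hBA]
    calc _ ≤ fsq (KK x q * (mfun L Real.exp - 1)) * fsq (KK x q)ᵀ := fsq_mul_le _ _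
      _ ≤ (fsq (KK x q) * fsq (mfun L Real.exp - 1)) * fsq (KK x q) := by
          rw [fsq_transpose]
          exact mul_le_mul_of_nonneg_right (fsq_mul_le _ _) (fsq_nonneg _)
      _ = fsq (KK x q) ^ 2 * fsq (mfun L Real.exp - 1) := by ring
      _ ≤ (n * Real.exp D) ^ 2 * (4 * fsq L) := by
          have := fsq_exp_sub_one hL hL1
          have h0 := fsq_nonneg (KK x q)
          have h1 := fsq_nonneg (mfun L Real.exp - 1)
          gcongr
      _ = _ := by ring
  -- linear term
  have hlin : (mfun (cg x q) (fun y => 2 * Real.log y / y) * (cg x (ex q L) - cg x q)).trace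
      = -2 * (ell q x * L).trace - 2 * (ell q x * (mfun L Real.exp - 1 - L)).trace := by
    have h1 : (KK x q)ᵀ * (mfun (cg x q) (fun y => 2 * Real.log y / y) * KK x q) = (-2 : ℝ) • ell q x := by
      rw [← KK_intertwine hx hq, ← Matrix.mul_assoc, KK_tr_mul hx hq,
        ← mfun_inv (cg_posDef hq hx) (fun y => 2 * Real.log y / y)]
      have hinv := (cg_posDef hq hx).inv
      conv_lhs => lhs; rw [← mfun_id hinv.1]
      rw [mfun_mul hinv.1, mfun_inv (cg_posDef hq hx), ell, mfun_smul (cg_herm q hx.1)]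
      refine mfun_congr_pos (cg_posDef hq hx) fun y hy => ?_
      rw [Real.log_inv]; field_simp
    rw [hBA]
    calc (mfun (cg x q) (fun y => 2 * Real.log y / y) *
          (KK x q * (mfun L Real.exp - 1) * (KK x q)ᵀ)).trace
        = ((KK x q)ᵀ * (mfun (cg x q) (fun y => 2 * Real.log y / y) * KK x q) *
          (mfun L Real.exp - 1)).trace := by
          rw [← Matrix.mul_assoc, Matrix.trace_mul_comm]; simp only [Matrix.mul_assoc]
      _ = _ := by
          rw [h1, Matrix.smul_mul, Matrix.trace_smul]
          have : mfun L Real.exp - 1 = L + (mfun L Real.exp - 1 - L) := by abel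
          conv_lhs => rw [this]
          rw [Matrix.mul_add, Matrix.trace_add, smul_eq_mul]; ring
  have hrem : |(ell q x * (mfun L Real.exp - 1 - L)).trace| ≤ D * fsq L := by
    refine (abs_trace_mul_le _ _).trans ?_
    have h1 : √(fsq (ell q x)) ≤ D := by rw [← dR_eq hx, dR_symm hq hx]; exact hd
    have h2 : √(fsq (mfun L Real.exp - 1 - L)) ≤ fsq L :=
      Real.sqrt_le_iff.2 ⟨fsq_nonneg _, fsq_exp_sub_one_sub hL hL1⟩
    gcongr
  rw [hlin] at hk
  have hk2 := abs_le.1 (hk.trans (mul_le_mul_of_nonneg_left hf hC1))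
  have hr2 := abs_le.1 hrem
  rw [abs_le]
  constructor <;> nlinarith

lemma minner_eq {q : Matrix (Fin n) (Fin n) ℝ} (hq : q.PosDef) (u v : Matrix (Fin n) (Fin n) ℝ) :
    minner q u v = (cg q u * cg q v).trace := by
  have hi : q⁻¹ = (msqrt q)⁻¹ * (msqrt q)⁻¹ := by
    rw [← Matrix.mul_inv_rev, msqrt_mul hq]
  rw [minner, hi, cg, cg]
  simp only [Matrix.mul_assoc]
  rw [Matrix.trace_mul_comm]
  simp only [Matrix.mul_assoc]

lemma cg_mlogP {q : Matrix (Fin n) (Fin n) ℝ} (hq : q.PosDef) (x : Matrix (Fin n) (Fin n) ℝ) :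
    cg q (mlogP q x) = ell q x := cg_conj hq _

lemma mnorm_eq {q v : Matrix (Fin n) (Fin n) ℝ} (hq : q.PosDef) (hv : v.IsHermitian) :
    mnorm q v = √(fsq (cg q v)) := by
  rw [mnorm, minner_eq hq, fsq_eq, herm_transpose (cg_herm q hv)]

lemma cg_smul (q v : Matrix (Fin n) (Fin n) ℝ) (r : ℝ) : cg q (r • v) = r • cg q v := by
  simp [cg]

lemma cg_add (q u v : Matrix (Fin n) (Fin n) ℝ) : cg q (u + v) = cg q u + cg q v := by
  simp [cg, Matrix.mul_add, Matrix.add_mul]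

lemma subgrad_ineq {f : Matrix (Fin n) (Fin n) ℝ → ℝ} {q s x : Matrix (Fin n) (Fin n) ℝ}
    (hs : IsSubgrad f q s) (hq : q.PosDef) (hx : x.PosDef) :
    f q + (cg q s * ell q x).trace ≤ f x := by
  have := hs.2 x hx
  rwa [minner_eq hq, cg_mlogP hq] at this

/-- Variational inequality for the projection. -/
lemma proj_vi {X : Set (Matrix (Fin n) (Fin n) ℝ)} (hX : ∀ x ∈ X, x.PosDef) (hc : GConvexSet X)
    {z p x : Matrix (Fin n) (Fin n) ℝ} (hz : z.PosDef) (hp : p ∈ X) (hx : x ∈ X)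
    (hn : ∀ y ∈ X, dR z p ≤ dR z y) : (ell p z * ell p x).trace ≤ 0 := by
  obtain ⟨C, hC, hE⟩ := expand (n := n) (dR z p) (Real.sqrt_nonneg _)
  by_contra! hτ
  set τ := (ell p z * ell p x).trace
  set N := fsq (ell p x)
  have hN : 0 ≤ N := fsq_nonneg _
  -- choose θ
  set θ := min (1 / (1 + N)) (τ / (1 + C * N)) with hθ
  have hCN : 0 ≤ C * N := by positivity
  have hθ0 : 0 < θ := lt_min (by positivity) (by positivity)
  have hθ1 : θ * (1 + N) ≤ 1 := by
    have : θ ≤ 1 / (1 + N) := min_le_left _ _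
    rwa [le_div_iff₀ (by positivity)] at this
  have hθ2 : θ * (1 + C * N) ≤ τ := by
    have : θ ≤ τ / (1 + C * N) := min_le_right _ _
    rwa [le_div_iff₀ (by positivity)] at this
  have hθle : θ ≤ 1 := by nlinarith
  have h1 : fsq (θ • ell p x) ≤ 1 := by
    rw [fsq_smul]
    change θ ^ 2 * N ≤ 1
    nlinarith [mul_nonneg hθ0.le hN]
  have hL : (θ • ell p x).IsHermitian := by
    rw [ell, mfun_smul (cg_herm p (hX x hx).1)]; exact mfun_herm _ _
  have := hE z p (θ • ell p x) hz (hX p hp) hL h1 le_rfl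
  rw [← gmean_eq (hX p hp) (hX x hx), fsq_smul, Matrix.mul_smul, Matrix.trace_smul,
    smul_eq_mul] at this
  have hm := hn _ (hc p hp x hx θ ⟨hθ0.le, hθle⟩)
  have h0 : 0 ≤ dR z p := Real.sqrt_nonneg _
  have hsq : dR z p ^ 2 ≤ dR z (gmean θ p x) ^ 2 := by gcongr
  have h3 := (abs_le.1 this).2
  change _ - _ + 2 * (θ * τ) ≤ C * (θ ^ 2 * N) at h3
  have h4 : θ * (2 * τ) ≤ θ * (θ * (C * N)) := by nlinarith
  have h5 := le_of_mul_le_mul_left h4 hθ0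
  nlinarith

/-- One step of the projected iteration. -/
lemma one_step (D : ℝ) (hD : 0 ≤ D) : ∃ C, 0 ≤ C ∧ ∀ X : Set (Matrix (Fin n) (Fin n) ℝ),
    (∀ x ∈ X, x.PosDef) → GConvexSet X → (∀ p ∈ X, ∀ q ∈ X, dR p q ≤ D) →
    ∀ x ∈ X, ∀ q ∈ X, ∀ p ∈ X, ∀ L : Matrix (Fin n) (Fin n) ℝ, L.IsHermitian → fsq L ≤ 1 →
    (∀ y ∈ X, dR (ex q L) p ≤ dR (ex q L) y) →
    dR x p ^ 2 ≤ dR x q ^ 2 - 2 * (ell q x * L).trace + C * fsq L := by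
  obtain ⟨C, hC, hE⟩ := expand (n := n) D hD
  refine ⟨2 * C, by positivity, fun X hX hc hdi x hx q hq p hp L hL hL1 hn => ?_⟩
  have hz := ex_posDef (hX q hq) hL
  have e1 := hE x q L (hX x hx) (hX q hq) hL hL1 (hdi x hx q hq)
  have hvi := proj_vi hX hc hz hp hx hn
  have hle : fsq (ell p (ex q L)) ≤ fsq L := by
    have h := hn q hq
    rw [dR_symm hz (hX p hp), dR_symm hz (hX q hq)] at h
    have h0 : 0 ≤ dR p (ex q L) := Real.sqrt_nonneg _
    have : dR p (ex q L) ^ 2 ≤ dR q (ex q L) ^ 2 := by gcongr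
    rwa [dR_sq hz, dR_sq hz, ell_ex (hX q hq) hL] at this
  have e2 := hE x p (ell p (ex q L)) (hX x hx) (hX p hp) (ell_herm _ _) (hle.trans hL1)
    (hdi x hx p hp)
  rw [ex_ell (hX p hp) hz, Matrix.trace_mul_comm] at e2
  have a1 := (abs_le.1 e1).2
  have a2 := (abs_le.1 e2).1
  have a3 := mul_le_mul_of_nonneg_left hle hC
  nlinarith

end SPDaux

namespace SPDaux

variable {n : ℕ}

lemma continuous_fsq : Continuous (fsq : Matrix (Fin n) (Fin n) ℝ → ℝ) := by
  unfold fsq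
  fun_prop

lemma abs_entry_le (A : Matrix (Fin n) (Fin n) ℝ) (i j : Fin n) : |A i j| ≤ √(fsq A) := by
  apply Real.abs_le_sqrt
  exact (Finset.single_le_sum (f := fun j => A i j ^ 2) (fun _ _ => sq_nonneg _)
    (Finset.mem_univ j)).trans (Finset.single_le_sum (f := fun i => ∑ j, A i j ^ 2)
      (fun _ _ => Finset.sum_nonneg fun _ _ => sq_nonneg _) (Finset.mem_univ i))

lemma isCompact_fsq_le (F : ℝ) : IsCompact {A : Matrix (Fin n) (Fin n) ℝ | fsq A ≤ F} := by
  have hbox : IsCompact (Set.pi Set.univ fun _ : Fin n => Set.pi Set.univ fun _ : Fin n =>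
      Set.Icc (-√F) (√F)) :=
    isCompact_univ_pi fun _ => isCompact_univ_pi fun _ => isCompact_Icc
  refine IsCompact.of_isClosed_subset hbox (isClosed_le continuous_fsq continuous_const) ?_
  intro A hA i _ j _
  exact abs_le.1 ((abs_entry_le A i j).trans (Real.sqrt_le_sqrt hA))

lemma exists_bound {f : Matrix (Fin n) (Fin n) ℝ → ℝ}
    (hfc : ContinuousOn f {m : Matrix (Fin n) (Fin n) ℝ | m.PosDef})
    {X : Set (Matrix (Fin n) (Fin n) ℝ)} (hX : ∀ x ∈ X, x.PosDef) (hXc : IsCompact X) :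
    ∃ B, ∀ q ∈ X, ∀ Y : Matrix (Fin n) (Fin n) ℝ, Y.IsHermitian → fsq Y ≤ 1 → f (ex q Y) ≤ B := by
  obtain ⟨T1, hT1⟩ := hXc.bddAbove_image (f := fun q : Matrix (Fin n) (Fin n) ℝ => q.trace)
    (by fun_prop)
  obtain ⟨T2, hT2⟩ := hXc.bddAbove_image (f := fun q : Matrix (Fin n) (Fin n) ℝ => (q⁻¹).trace)
    (by
      have e : (fun q : Matrix (Fin n) (Fin n) ℝ => (q⁻¹).trace)
          = fun q => (q.det)⁻¹ * q.adjugate.trace := by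
        funext q
        rw [Matrix.inv_def, Matrix.trace_smul, Ring.inverse_eq_inv', smul_eq_mul]
      rw [e]
      refine ContinuousOn.mul (ContinuousOn.inv₀ ?_ fun q hq => (hX q hq).det_pos.ne') ?_
      · exact (continuous_id.matrix_det).continuousOn
      · exact (continuous_id.matrix_adjugate.matrix_trace).continuousOn)
  set F := max (T1 * (n * Real.exp 1)) (T2 * (n * Real.exp 1)) with hF
  let S : Set (Matrix (Fin n) (Fin n) ℝ × Matrix (Fin n) (Fin n) ℝ) :=
    {w | fsq w.1 ≤ F} ∩ {w | fsq w.2 ≤ F} ∩ {w | w.1 * w.2 = 1}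
  have hS : IsCompact S := by
    have h1 := (isCompact_fsq_le (n := n) F).prod (isCompact_fsq_le (n := n) F)
    have h2 : IsClosed {w : Matrix (Fin n) (Fin n) ℝ × Matrix (Fin n) (Fin n) ℝ | w.1 * w.2 = 1} :=
      isClosed_eq (by fun_prop) continuous_const
    refine (h1.inter_right h2).of_isClosed_subset ?_ ?_
    · refine (IsClosed.inter ?_ ?_).inter h2
      · exact isClosed_le (continuous_fsq.comp continuous_fst) continuous_const
      · exact isClosed_le (continuous_fsq.comp continuous_snd) continuous_const
    · rintro w ⟨⟨a, b⟩, c⟩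
      exact ⟨⟨a, b⟩, c⟩
  have hcont : ContinuousOn (fun w : Matrix (Fin n) (Fin n) ℝ × Matrix (Fin n) (Fin n) ℝ =>
      f (w.1 * w.1ᵀ)) S := by
    refine hfc.comp (Continuous.continuousOn (by fun_prop)) ?_
    rintro w ⟨_, c⟩
    have := posDef_cong (Matrix.PosDef.one (n := Fin n) (R := ℝ)) (isUnit_of_mul c)
    simpa using this
  obtain ⟨B, hB⟩ := hS.bddAbove_image hcont
  refine ⟨B, fun q hq Y hY hY1 => ?_⟩
  have hqp := hX q hq
  have hexp : ∀ σ : ℝ, |σ| ≤ 1 / 2 → fsq (mfun Y (fun x => Real.exp (σ * x))) ≤ n * Real.exp 1 := by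
    intro σ hσ
    rw [fsq_mfun hY]
    refine (Finset.sum_le_sum (g := fun _ => Real.exp 1) fun i _ => ?_).trans (by simp)
    rw [← Real.exp_nat_mul]
    apply Real.exp_le_exp.2
    have h1 := abs_eigs_le hY hY1 i
    have h2 : |σ * eigs Y i| ≤ 1 / 2 * 1 := by rw [abs_mul]; gcongr
    have := (abs_le.1 h2).2
    push_cast; linarith
  have hR : fsq (msqrt q) ≤ T1 := by
    rw [fsq_eq, msqrt_tr, msqrt_mul hqp]; exact hT1 ⟨q, hq, rfl⟩
  have hRi : fsq (msqrt q)⁻¹ ≤ T2 := by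
    rw [fsq_eq, msqrt_inv_tr, ← Matrix.mul_inv_rev, msqrt_mul hqp]; exact hT2 ⟨q, hq, rfl⟩
  have hn : (0:ℝ) ≤ n * Real.exp 1 := by positivity
  have hmem : (msqrt q * mfun Y (fun x => Real.exp ((1/2) * x)),
      mfun Y (fun x => Real.exp ((-(1/2)) * x)) * (msqrt q)⁻¹) ∈ S := by
    refine ⟨⟨?_, ?_⟩, ?_⟩
    · refine (fsq_mul_le _ _).trans (le_trans ?_ (le_max_left _ _))
      exact mul_le_mul hR (hexp _ (by norm_num [abs_of_pos])) (fsq_nonneg _)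
        ((fsq_nonneg _).trans hR)
    · refine (fsq_mul_le _ _).trans (le_trans ?_ (le_max_right _ _))
      rw [mul_comm]
      exact mul_le_mul hRi (hexp _ (by rw [abs_neg]; norm_num [abs_of_pos])) (fsq_nonneg _)
        ((fsq_nonneg _).trans hRi)
    · change msqrt q * mfun Y (fun x => Real.exp ((1/2) * x)) *
        (mfun Y (fun x => Real.exp ((-(1/2)) * x)) * (msqrt q)⁻¹) = 1
      rw [Matrix.mul_assoc, ← Matrix.mul_assoc (mfun Y _), mfun_mul hY]
      have : (fun x : ℝ => Real.exp ((1/2) * x) * Real.exp ((-(1/2)) * x)) = fun _ => 1 := by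
        funext x; rw [← Real.exp_add]; ring_nf; simp
      rw [this, mfun_one hY, Matrix.one_mul, msqrt_mul_inv hqp]
  have := hB ⟨_, hmem, rfl⟩
  refine le_trans (le_of_eq ?_) this
  dsimp only
  congr 1
  rw [transpose_mul, msqrt_tr, herm_transpose (mfun_herm _ _), Matrix.mul_assoc,
    ← Matrix.mul_assoc (mfun Y _), mfun_mul hY, ex, Matrix.mul_assoc]
  congr 3
  funext x
  rw [← Real.exp_add]; ring_nf

lemma subgrad_bound {f : Matrix (Fin n) (Fin n) ℝ → ℝ} {q s : Matrix (Fin n) (Fin n) ℝ} {B : ℝ}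
    (hq : q.PosDef) (hs : IsSubgrad f q s)
    (hB : ∀ Y : Matrix (Fin n) (Fin n) ℝ, Y.IsHermitian → fsq Y ≤ 1 → f (ex q Y) ≤ B) :
    √(fsq (cg q s)) ≤ B - f q := by
  set r := √(fsq (cg q s)) with hr
  have hr0 : 0 ≤ r := Real.sqrt_nonneg _
  have hrr : r ^ 2 = fsq (cg q s) := Real.sq_sqrt (fsq_nonneg _)
  have hS := cg_herm q hs.1
  set Y := r⁻¹ • cg q s with hY
  have hYh : Y.IsHermitian := by
    rw [hY, ← mfun_id hS, mfun_smul hS]; exact mfun_herm _ _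
  have hY1 : fsq Y ≤ 1 := by
    rw [hY, fsq_smul, ← hrr, ← mul_pow]
    by_cases h : r = 0
    · simp [h]
    · rw [inv_mul_cancel₀ h]; norm_num
  have h1 := subgrad_ineq hs hq (ex_posDef hq hYh)
  rw [ell_ex hq hYh] at h1
  have h2 : (cg q s * Y).trace = r := by
    rw [hY, Matrix.mul_smul, Matrix.trace_smul, smul_eq_mul]
    have : (cg q s * cg q s).trace = r ^ 2 := by
      rw [hrr, fsq_eq, herm_transpose hS]
    rw [this]
    by_cases h : r = 0
    · simp [h]
    · field_simp
  have := hB Y hYh hY1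
  linarith

lemma seq_contra (Φ t : ℕ → ℝ) (hΦ : ∀ k, 0 ≤ Φ k) (c C : ℝ) (hc : 0 < c) (hC : 0 ≤ C) (K : ℕ)
    (hstep : ∀ k ≥ K, Φ (k + 1) ≤ Φ k - c * t k + C * t k ^ 2)
    (htdiv : Tendsto (fun N => ∑ k ∈ Finset.range N, t k) atTop atTop)
    (htsq : Summable (fun k => t k ^ 2)) : False := by
  set Ψ : ℕ → ℝ := fun N => Φ N + c * ∑ k ∈ Finset.range N, t k
    - C * ∑ k ∈ Finset.range N, t k ^ 2 with hΨ
  have hmono : ∀ N ≥ K, Ψ N ≤ Ψ K := by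
    intro N hN
    induction N, hN using Nat.le_induction with
    | base => exact le_rfl
    | succ N hN ih =>
      refine le_trans ?_ ih
      simp only [hΨ, Finset.sum_range_succ]
      linarith [hstep N hN]
  obtain ⟨N, hN, hNK⟩ := ((htdiv.eventually_gt_atTop
    ((Ψ K + C * ∑' k, t k ^ 2) / c)).and (eventually_ge_atTop K)).exists
  have h1 := hmono N hNK
  have h2 : ∑ k ∈ Finset.range N, t k ^ 2 ≤ ∑' k, t k ^ 2 :=
    htsq.sum_le_tsum _ fun _ _ => sq_nonneg _
  rw [div_lt_iff₀ hc] at hN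
  have h3 : Φ N + c * ∑ k ∈ Finset.range N, t k - C * ∑ k ∈ Finset.range N, t k ^ 2 ≤ Ψ K := h1
  nlinarith [hΦ N, mul_le_mul_of_nonneg_left h2 hC]

lemma frequently_lt
    (f : Matrix (Fin n) (Fin n) ℝ → ℝ)
    (hfc : ContinuousOn f {m : Matrix (Fin n) (Fin n) ℝ | m.PosDef})
    (X : Set (Matrix (Fin n) (Fin n) ℝ)) (hXpos : ∀ x ∈ X, x.PosDef)
    (hXne : X.Nonempty) (hXcpt : IsCompact X) (hXconv : GConvexSet X)
    (D : ℝ) (hD : 0 < D) (hdiam : ∀ p ∈ X, ∀ q ∈ X, dR p q ≤ D)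
    (p s u : ℕ → Matrix (Fin n) (Fin n) ℝ) (t : ℕ → ℝ)
    (hit : Iter f X p s u t) (ht : ∀ k, 0 < t k)
    (htdiv : Tendsto (fun N => ∑ k ∈ Finset.range N, t k) atTop atTop)
    (htsq : Summable (fun k => t k ^ 2))
    (ε : ℝ) (hε : 0 < ε) (kbar : ℕ) (hu : ∀ k ≥ kbar, mnorm (p k) (u k) ≤ ε)
    (hmem : ∀ k, p k ∈ X) (δ : ℝ) (hδ : 0 < δ) :
    ∃ᶠ k in atTop, f (p k) < sInf (f '' X) + ε * D + δ := by
  have hfX : ContinuousOn f X := hfc.mono hXpos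
  obtain ⟨x, hx, hxmin⟩ := hXcpt.exists_isMinOn hXne hfX
  have hinf : sInf (f '' X) = f x := by
    apply IsLeast.csInf_eq
    exact ⟨⟨x, hx, rfl⟩, by rintro _ ⟨y, hy, rfl⟩; exact hxmin hy⟩
  rw [hinf]
  by_contra hcon
  rw [not_frequently] at hcon
  simp only [not_lt] at hcon
  have ht1 : ∀ᶠ k in atTop, t k ^ 2 < 1 := htsq.tendsto_atTop_zero.eventually_lt_const one_pos
  obtain ⟨K, hK⟩ := eventually_atTop.1 ((hcon.and ht1).and (eventually_ge_atTop kbar))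
  obtain ⟨B, hB⟩ := exists_bound hfc hXpos hXcpt
  obtain ⟨C, hC, hstep⟩ := one_step (n := n) D hD.le
  set G2 := 2 * (B - f x) ^ 2 + 2 * ε ^ 2 with hG2
  have hG2pos : 0 < G2 := by positivity
  have hG : 0 < √G2 := Real.sqrt_pos.2 hG2pos
  refine seq_contra (fun k => dR x (p k) ^ 2) t (fun k => sq_nonneg _) (2 * δ / √G2) C
    (by positivity) hC K ?_ htdiv htsq
  intro k hk
  obtain ⟨⟨hfk, htk⟩, hkb⟩ := hK k hk
  have hq := hXpos _ (hmem k)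
  have hs := hit.subgrad k
  have huh := hit.u_herm k
  have hvh : (s k + u k).IsHermitian := hs.1.add huh
  set q := p k with hqdef
  set V := cg q (s k + u k) with hV
  have hVh : V.IsHermitian := cg_herm q hvh
  have hnorm : mnorm q (s k + u k) = √(fsq V) := mnorm_eq hq hvh
  have hVne : fsq V ≠ 0 := by
    intro h0
    have h1 := fsq_eq_zero h0
    have h2 := conj_cg hq (s k + u k)
    rw [← hV, h1] at h2
    exact hit.v_ne k (by rw [← h2]; simp)
  have hVpos : 0 < fsq V := lt_of_le_of_ne (fsq_nonneg _) (Ne.symm hVne)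
  have hVs : 0 < √(fsq V) := Real.sqrt_pos.2 hVpos
  have hVsq : √(fsq V) ^ 2 = fsq V := Real.sq_sqrt hVpos.le
  set L := -(t k / √(fsq V)) • V with hL
  have hLh : L.IsHermitian := by
    rw [hL, ← mfun_id hVh, mfun_smul hVh]; exact mfun_herm _ _
  have hLf : fsq L = t k ^ 2 := by
    rw [hL, fsq_smul, neg_sq, div_pow, hVsq]; field_simp
  have hz : mexpP q (-(t k / mnorm q (s k + u k)) • (s k + u k)) = ex q L := by
    rw [mexpP_eq, cg_smul, hnorm]
  have hmain := hstep X hXpos hXconv hdiam x hx q (hmem k) (p (k + 1)) (hmem _) L hLh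
    (by rw [hLf]; exact htk.le) (by
      intro y hy
      have := hit.proj_nearest k y hy
      rwa [hz] at this)
  rw [hLf] at hmain
  -- bound on V
  have hun : √(fsq (cg q (u k))) ≤ ε := by
    rw [← mnorm_eq hq huh]; exact hu k hkb
  have hsn := subgrad_bound hq hs (hB q (hmem k))
  have hxq : f x ≤ f q := hxmin (hmem k)
  have hVle : √(fsq V) ≤ √G2 := by
    apply Real.sqrt_le_sqrt
    rw [hV, cg_add]
    refine (fsq_add_le _ _).trans ?_
    have a1 : fsq (cg q (s k)) ≤ (B - f x) ^ 2 := by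
      rw [← Real.sq_sqrt (fsq_nonneg (cg q (s k)))]
      have := Real.sqrt_nonneg (fsq (cg q (s k)))
      gcongr; linarith
    have a2 : fsq (cg q (u k)) ≤ ε ^ 2 := by
      rw [← Real.sq_sqrt (fsq_nonneg (cg q (u k)))]
      gcongr
    linarith
  -- inner product
  have hin : (ell q x * V).trace ≤ -δ := by
    rw [hV, cg_add, Matrix.mul_add, Matrix.trace_add]
    have b1 := subgrad_ineq hs hq (hXpos x hx)
    rw [Matrix.trace_mul_comm] at b1
    have b2 := (le_abs_self _).trans (abs_trace_mul_le (ell q x) (cg q (u k)))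
    have b3 : √(fsq (ell q x)) ≤ D := by
      rw [← dR_eq (hXpos x hx)]; exact hdiam q (hmem k) x hx
    have b4 : √(fsq (ell q x)) * √(fsq (cg q (u k))) ≤ D * ε := by gcongr
    linarith
  have htr : -2 * (ell q x * L).trace = 2 * (t k / √(fsq V)) * (ell q x * V).trace := by
    rw [hL, Matrix.mul_smul, Matrix.trace_smul, smul_eq_mul]; ring
  have hfin : 2 * (t k / √(fsq V)) * (ell q x * V).trace ≤ -(2 * δ / √G2 * t k) := by
    have c1 : t k / √G2 ≤ t k / √(fsq V) := by
      have := (ht k).le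
      gcongr
    have c0 : 0 ≤ t k / √(fsq V) := div_nonneg (ht k).le hVs.le
    have c2 : 2 * δ / √G2 * t k = 2 * δ * (t k / √G2) := by ring
    rw [c2]
    nlinarith [mul_le_mul_of_nonneg_left hin c0, mul_le_mul_of_nonneg_left c1 hδ.le]
  linarith

end SPDaux

/-- Convergence of the inexact projected subgradient method with exogenous
step sizes: `liminf f(p_k) ≤ f* + εD`, and some cluster point `p*` of `{p_k}` satisfies
`f(p*) ≤ f* + εD`. -/
theorem convergence_exogenous {n : ℕ}
    (f : Matrix (Fin n) (Fin n) ℝ → ℝ) (hf : GConvexFun f)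
    (hfc : ContinuousOn f {m : Matrix (Fin n) (Fin n) ℝ | m.PosDef})
    (X : Set (Matrix (Fin n) (Fin n) ℝ)) (hXpos : ∀ x ∈ X, x.PosDef)
    (hXne : X.Nonempty) (hXcpt : IsCompact X) (hXconv : GConvexSet X)
    (D : ℝ) (hD : 0 < D) (hdiam : ∀ p ∈ X, ∀ q ∈ X, dR p q ≤ D)
    (p s u : ℕ → Matrix (Fin n) (Fin n) ℝ) (t : ℕ → ℝ)
    (hit : Iter f X p s u t) (ht : ∀ k, 0 < t k)
    (htdiv : Tendsto (fun N => ∑ k ∈ Finset.range N, t k) atTop atTop)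
    (htsq : Summable (fun k => t k ^ 2))
    (ε : ℝ) (hε : 0 < ε) (kbar : ℕ) (hu : ∀ k ≥ kbar, mnorm (p k) (u k) ≤ ε) :
    Filter.liminf (fun k => f (p k)) atTop ≤ sInf (f '' X) + ε * D
    ∧ ∃ pstar ∈ X, MapClusterPt pstar atTop p ∧ f pstar ≤ sInf (f '' X) + ε * D := by
  have hmem : ∀ k, p k ∈ X := by
    intro k
    cases k with
    | zero => exact hit.p0_mem
    | succ k => exact hit.proj_mem k
  have hfX : ContinuousOn f X := hfc.mono hXpos
  have hfreq := SPDaux.frequently_lt f hfc X hXpos hXne hXcpt hXconv D hD hdiam p s u t hit ht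
    htdiv htsq ε hε kbar hu hmem
  constructor
  · apply le_of_forall_pos_le_add
    intro δ hδ
    refine Filter.liminf_le_of_frequently_le ((hfreq δ hδ).mono fun k hk => hk.le) ?_
    obtain ⟨b, hb⟩ := hXcpt.bddBelow_image hfX
    refine Filter.isBoundedUnder_of ⟨b, fun k => ?_⟩
    exact hb (Set.mem_image_of_mem f (hmem k))
  · have hfreq' : ∀ m : ℕ, ∃ᶠ k in atTop,
        f (p k) < sInf (f '' X) + ε * D + 1 / ((m : ℝ) + 1) := fun m =>
      hfreq _ (by positivity)
    obtain ⟨φ, hφ, hφlt⟩ := Filter.extraction_forall_of_frequently hfreq'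
    have : FirstCountableTopology (Matrix (Fin n) (Fin n) ℝ) :=
      inferInstanceAs (FirstCountableTopology (Fin n → Fin n → ℝ))
    obtain ⟨pstar, hpX, ψ, hψ, hlim⟩ := hXcpt.tendsto_subseq (fun m => hmem (φ m))
    refine ⟨pstar, hpX, ?_, ?_⟩
    · exact MapClusterPt.of_comp (hφ.comp hψ).tendsto_atTop hlim.mapClusterPt
    · have h1 : Tendsto (fun m => f (p (φ (ψ m)))) atTop (nhds (f pstar)) := by
        have h0 : Tendsto (fun m => p (φ (ψ m))) atTop (nhdsWithin pstar X) :=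
          tendsto_nhdsWithin_iff.2 ⟨hlim, Eventually.of_forall fun m => hmem _⟩
        exact (hfX pstar hpX).tendsto.comp h0
      have h2 : Tendsto (fun m : ℕ => sInf (f '' X) + ε * D + 1 / (((ψ m : ℕ) : ℝ) + 1)) atTop
          (nhds (sInf (f '' X) + ε * D + 0)) :=
        tendsto_const_nhds.add
          (tendsto_one_div_add_atTop_nhds_zero_nat.comp hψ.tendsto_atTop)
      rw [add_zero] at h2
      exact le_of_tendsto_of_tendsto' h1 h2 fun m => (hφlt (ψ m)).le
end

section
/- (Complexity bound with constant step size.) Let f : S⁺_n → ℝ be geodesically convex, let X ⊆ S⁺_n be a nonempty compact geodesically convex set with diam(X) < D for some D > 0, and let f* := inf_{p ∈ X} f(p). Let {p_k} be generated by the inexact projected subgradient iteration with p₀ ∈ X, v_k = s_k + u_k ≠ 0, s_k ∈ ∂f(p_k), and constant step size t_k = t̄ > 0 for all k. Set κ̂ = 1/√2 and ζ := D·sinh(κ̂ t̄)/(t̄·tanh(κ̂D)). Let ε > 0, ι > 0, N ∈ ℕ. If ‖u_k‖_{p_k} ≤ ε and ‖s_k‖_{p_k} ≤ ι for all k ∈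 {0,1,…,N−1}, then min{ f(p_k) − (f* + εD) : k = 0,1,…,N−1 } ≤ (ε + ι)·( D² + ζ·N·t̄² )/( 2·N·t̄ ). -/
open Matrix Real Filter

namespace SPD

variable {n : ℕ}

noncomputable def evec (A : Matrix (Fin n) (Fin n) ℝ) : Matrix (Fin n) (Fin n) ℝ :=
  if h : A.IsHermitian then (h.eigenvectorUnitary : Matrix (Fin n) (Fin n) ℝ) else 1

lemma evec_tm (A : Matrix (Fin n) (Fin n) ℝ) : (evec A)ᵀ * evec A = 1 := by
  unfold evec
  split_ifs with h
  · have := Unitary.star_mul_self_of_mem h.eigenvectorUnitary.2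
    rwa [star_eq_conjTranspose, conjTranspose_eq_transpose_of_trivial] at this
  · simp

lemma evec_mt (A : Matrix (Fin n) (Fin n) ℝ) : evec A * (evec A)ᵀ = 1 :=
  mul_eq_one_comm.mp (evec_tm A)

lemma mfun_eq {A : Matrix (Fin n) (Fin n) ℝ} (hA : A.IsHermitian) (f : ℝ → ℝ) :
    mfun A f = evec A * diagonal (fun i => f (eigs A i)) * (evec A)ᵀ := by
  simp only [mfun, evec, eigs, hA, dif_pos, IsHermitian.cfc, Unitary.conjStarAlgAut_apply]
  rw [star_eq_conjTranspose, conjTranspose_eq_transpose_of_trivial]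
  rfl

lemma spec {A : Matrix (Fin n) (Fin n) ℝ} (hA : A.IsHermitian) :
    A = evec A * diagonal (eigs A) * (evec A)ᵀ := by
  have := hA.spectral_theorem
  simp only [evec, eigs, hA, dif_pos]
  conv_lhs => rw [this]
  rw [Unitary.conjStarAlgAut_apply, star_eq_conjTranspose,
    conjTranspose_eq_transpose_of_trivial]
  rfl

lemma evec_tA {A : Matrix (Fin n) (Fin n) ℝ} (hA : A.IsHermitian) :
    (evec A)ᵀ * A = diagonal (eigs A) * (evec A)ᵀ := by
  have h := congrArg (fun Z => (evec A)ᵀ * Z) (spec hA)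
  simpa only [← Matrix.mul_assoc, evec_tm, Matrix.one_mul] using h

lemma evec_Am {A : Matrix (Fin n) (Fin n) ℝ} (hA : A.IsHermitian) :
    A * evec A = evec A * diagonal (eigs A) := by
  have h := congrArg (fun Z => Z * evec A) (spec hA)
  simpa only [Matrix.mul_assoc, evec_tm, Matrix.mul_one] using h

lemma mfun_id {A : Matrix (Fin n) (Fin n) ℝ} (hA : A.IsHermitian) : mfun A (fun x => x) = A := by
  rw [mfun_eq hA]; exact (spec hA).symm

lemma mfun_one {A : Matrix (Fin n) (Fin n) ℝ} (hA : A.IsHermitian) : mfun A (fun _ => 1) = 1 := by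
  rw [mfun_eq hA]; simp [evec_mt]

lemma mfun_mul {A : Matrix (Fin n) (Fin n) ℝ} (hA : A.IsHermitian) (f g : ℝ → ℝ) :
    mfun A f * mfun A g = mfun A (fun x => f x * g x) := by
  rw [mfun_eq hA, mfun_eq hA, mfun_eq hA]
  calc _ = evec A * diagonal (fun i => f (eigs A i)) * ((evec A)ᵀ * evec A) *
      diagonal (fun i => g (eigs A i)) * (evec A)ᵀ := by simp only [Matrix.mul_assoc]
    _ = _ := by rw [evec_tm, Matrix.mul_one, Matrix.mul_assoc (evec A), diagonal_mul_diagonal]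

lemma mfun_herm (A : Matrix (Fin n) (Fin n) ℝ) (f : ℝ → ℝ) : (mfun A f).IsHermitian := by
  by_cases hA : A.IsHermitian
  · rw [mfun_eq hA, IsHermitian, conjTranspose_eq_transpose_of_trivial]
    simp [Matrix.mul_assoc]
  · rw [mfun, dif_neg hA]; exact isHermitian_zero

lemma mfun_tr (A : Matrix (Fin n) (Fin n) ℝ) (f : ℝ → ℝ) : (mfun A f)ᵀ = mfun A f := by
  have := mfun_herm A f
  rwa [IsHermitian, conjTranspose_eq_transpose_of_trivial] at this

lemma herm_tr {A : Matrix (Fin n) (Fin n) ℝ} : A.IsHermitian ↔ Aᵀ = A := by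
  rw [IsHermitian, conjTranspose_eq_transpose_of_trivial]

lemma mfun_congr {A : Matrix (Fin n) (Fin n) ℝ} (f g : ℝ → ℝ)
    (h : ∀ i, f (eigs A i) = g (eigs A i)) : mfun A f = mfun A g := by
  by_cases hA : A.IsHermitian
  · rw [mfun_eq hA, mfun_eq hA]; simp only [h]
  · rw [mfun, mfun, dif_neg hA, dif_neg hA]

lemma eigs_pos {A : Matrix (Fin n) (Fin n) ℝ} (hA : A.PosDef) (i : Fin n) : 0 < eigs A i := by
  have := hA.eigenvalues_pos i
  rw [eigs, dif_pos hA.1]; exact this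

lemma mfun_trace {A : Matrix (Fin n) (Fin n) ℝ} (hA : A.IsHermitian) (f : ℝ → ℝ) :
    (mfun A f).trace = ∑ i, f (eigs A i) := by
  rw [mfun_eq hA, trace_mul_comm, ← Matrix.mul_assoc, evec_tm, Matrix.one_mul, trace_diagonal]

/-- general intertwining -/
lemma intertwine {A B X : Matrix (Fin n) (Fin n) ℝ} (hA : A.IsHermitian) (hB : B.IsHermitian)
    (a b f g : ℝ → ℝ)
    (h : ∀ j i, a (eigs A j) = b (eigs B i) → f (eigs A j) = g (eigs B i))
    (hX : X * mfun A a = mfun B b * X) : X * mfun A f = mfun B g * X := by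
  have key : ∀ F G : ℝ → ℝ, (X * mfun A F = mfun B G * X) ↔
      ((evec B)ᵀ * X * evec A) * diagonal (fun i => F (eigs A i)) =
        diagonal (fun i => G (eigs B i)) * ((evec B)ᵀ * X * evec A) := by
    intro F G
    rw [mfun_eq hA, mfun_eq hB]
    constructor
    · intro h
      calc _ = (evec B)ᵀ * (X * (evec A * diagonal (fun i => F (eigs A i)) * (evec A)ᵀ)) * evec A := by
            simp only [Matrix.mul_assoc, evec_tm, Matrix.mul_one]
        _ = _ := by
            rw [h]
            simp only [← Matrix.mul_assoc, evec_tm, Matrix.one_mul]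
    · intro h
      calc _ = evec B * ((evec B)ᵀ * X * evec A * diagonal (fun i => F (eigs A i))) * (evec A)ᵀ := by
            simp only [← Matrix.mul_assoc, evec_mt, Matrix.one_mul]
        _ = _ := by
            rw [h]
            simp only [Matrix.mul_assoc, evec_mt, Matrix.mul_one]
  rw [key] at hX ⊢
  ext i j
  have hij := congrFun (congrFun hX i) j
  rw [mul_diagonal, diagonal_mul] at hij ⊢
  by_cases hz : ((evec B)ᵀ * X * evec A) i j = 0
  · simp [hz]
  · have : a (eigs A j) = b (eigs B i) := by
      apply mul_left_cancel₀ hz; rw [hij]; ring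
    rw [h j i this]; ring

/-- The two-variable functional calculus. -/
noncomputable def dmat (A C X : Matrix (Fin n) (Fin n) ℝ) (F : ℝ → ℝ → ℝ) :
    Matrix (Fin n) (Fin n) ℝ :=
  evec A * Matrix.of (fun k l => F (eigs A k) (eigs C l) * ((evec A)ᵀ * X * evec C) k l) *
    (evec C)ᵀ

lemma dmat_apply (A C X : Matrix (Fin n) (Fin n) ℝ) (F : ℝ → ℝ → ℝ) (i j : Fin n) :
    dmat A C X F i j = ∑ l, ∑ k, F (eigs A k) (eigs C l) *
      (evec A i k * ((evec A)ᵀ * X * evec C) k l * evec C j l) := by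
  unfold dmat
  rw [Matrix.mul_apply]
  refine Finset.sum_congr rfl fun l _ => ?_
  rw [Matrix.mul_apply, Finset.sum_mul]
  refine Finset.sum_congr rfl fun k _ => ?_
  simp only [of_apply, transpose_apply]; ring

lemma dmat_prod {A C : Matrix (Fin n) (Fin n) ℝ} (hA : A.IsHermitian) (hC : C.IsHermitian)
    (X : Matrix (Fin n) (Fin n) ℝ) (f g : ℝ → ℝ) :
    dmat A C X (fun x y => f x * g y) = mfun A f * X * mfun C g := by
  have : Matrix.of (fun k l => f (eigs A k) * g (eigs C l) * ((evec A)ᵀ * X * evec C) k l) =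
      diagonal (fun i => f (eigs A i)) * ((evec A)ᵀ * X * evec C) *
        diagonal (fun i => g (eigs C i)) := by
    ext i j
    rw [mul_diagonal, diagonal_mul, of_apply]; ring
  unfold dmat
  rw [this, mfun_eq hA, mfun_eq hC]
  simp only [Matrix.mul_assoc]

lemma dmat_sub (A C X : Matrix (Fin n) (Fin n) ℝ) (F G : ℝ → ℝ → ℝ) :
    dmat A C X (fun x y => F x y - G x y) = dmat A C X F - dmat A C X G := by
  ext i j
  simp only [Matrix.sub_apply, dmat_apply, sub_mul, Finset.sum_sub_distrib]

lemma dmat_diff {A C : Matrix (Fin n) (Fin n) ℝ} (hA : A.IsHermitian) (hC : C.IsHermitian)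
    (F : ℝ → ℝ → ℝ) :
    dmat A C (A - C) F = dmat A C 1 (fun x y => (x - y) * F x y) := by
  have e : (evec A)ᵀ * (A - C) * evec C =
      diagonal (eigs A) * ((evec A)ᵀ * 1 * evec C) -
        ((evec A)ᵀ * 1 * evec C) * diagonal (eigs C) := by
    rw [Matrix.mul_sub, Matrix.sub_mul]
    congr 1
    · rw [evec_tA hA, Matrix.mul_one, Matrix.mul_assoc]
    · rw [Matrix.mul_assoc, evec_Am hC, Matrix.mul_one, Matrix.mul_assoc]
  ext i j
  simp only [dmat_apply, e, Matrix.sub_apply, mul_diagonal, diagonal_mul]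
  refine Finset.sum_congr rfl fun l _ => Finset.sum_congr rfl fun k _ => ?_
  ring

lemma dmat_log {A C : Matrix (Fin n) (Fin n) ℝ} (hA : A.IsHermitian) (hC : C.IsHermitian)
    (f : ℝ → ℝ) :
    mfun A f - mfun C f = dmat A C 1 (fun x y => f x - f y) := by
  have := dmat_sub A C 1 (fun x y => f x * 1) (fun x y => 1 * f y)
  rw [dmat_prod hA hC, dmat_prod hA hC, mfun_one hA, mfun_one hC] at this
  simpa using this.symm

end SPD

namespace SPD

lemma sinh_le_mul_cosh {w : ℝ} (hw : 0 ≤ w) : sinh w ≤ w * cosh w := by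
  have hd : ∀ x, HasDerivAt (fun x => x * cosh x - sinh x) (x * sinh x) x := by
    intro x
    have := ((hasDerivAt_id x).mul (hasDerivAt_cosh x)).sub (hasDerivAt_sinh x)
    refine this.congr_deriv ?_
    simp
  have hm : MonotoneOn (fun x => x * cosh x - sinh x) (Set.Ici 0) := by
    apply monotoneOn_of_deriv_nonneg (convex_Ici 0)
    · exact fun x _ => (hd x).continuousAt.continuousWithinAt
    · exact fun x _ => (hd x).differentiableAt.differentiableWithinAt
    · intro x hx
      rw [interior_Ici] at hx
      rw [(hd x).deriv]
      exact mul_nonneg (le_of_lt hx) (sinh_nonneg_iff.mpr (le_of_lt hx))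
  have := hm (Set.mem_Ici.mpr le_rfl) hw hw
  simp at this; linarith

lemma xcoth_mono {w z : ℝ} (hw : 0 < w) (hz : w ≤ z) :
    w * cosh w / sinh w ≤ z * cosh z / sinh z := by
  have hd : ∀ x, 0 < x → HasDerivAt (fun x => x * cosh x / sinh x)
      (((cosh x + x * sinh x) * sinh x - x * cosh x * cosh x) / sinh x ^ 2) x := by
    intro x hx
    have := ((hasDerivAt_id x).mul (hasDerivAt_cosh x)).div (hasDerivAt_sinh x)
      (sinh_pos_iff.mpr hx).ne'
    refine this.congr_deriv ?_
    simp
  have hm : MonotoneOn (fun x => x * cosh x / sinh x) (Set.Ioi 0) := by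
    apply monotoneOn_of_deriv_nonneg (convex_Ioi 0)
    · exact fun x hx => (hd x hx).continuousAt.continuousWithinAt
    · rw [interior_Ioi]; exact fun x hx => (hd x hx).differentiableAt.differentiableWithinAt
    · intro x hx
      rw [interior_Ioi] at hx
      have hx : 0 < x := hx
      rw [(hd x hx).deriv]
      apply div_nonneg _ (sq_nonneg _)
      have h1 : x ≤ sinh x := self_le_sinh_iff.mpr hx.le
      have h2 := one_le_cosh x
      have h3 := cosh_sq x
      have h4 : x ≤ sinh x * cosh x := by nlinarith
      nlinarith
  exact hm hw (lt_of_lt_of_le hw hz) hz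

lemma sinh_div_mono {x y : ℝ} (hx : 0 ≤ x) (hy : x ≤ y) : y * sinh x ≤ x * sinh y := by
  rcases hx.eq_or_lt with rfl | hx0
  · simp
  have hd : ∀ x, 0 < x → HasDerivAt (fun x => sinh x / x)
      ((cosh x * x - sinh x * 1) / x ^ 2) x := by
    intro x hx
    exact (hasDerivAt_sinh x).div (hasDerivAt_id x) hx.ne'
  have hm : MonotoneOn (fun x => sinh x / x) (Set.Ioi 0) := by
    apply monotoneOn_of_deriv_nonneg (convex_Ioi 0)
    · exact fun x hx => (hd x hx).continuousAt.continuousWithinAt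
    · rw [interior_Ioi]; exact fun x hx => (hd x hx).differentiableAt.differentiableWithinAt
    · intro x hx
      rw [interior_Ioi] at hx
      have hx : 0 < x := hx
      rw [(hd x hx).deriv]
      apply div_nonneg _ (sq_nonneg _)
      have := sinh_le_mul_cosh hx.le
      linarith
  have := hm hx0 (lt_of_lt_of_le hx0 hy) hy
  simp only at this
  rw [div_le_div_iff₀ hx0 (lt_of_lt_of_le hx0 hy)] at this
  linarith

lemma cosh_sq_tangent {x y : ℝ} (hx : 0 ≤ x) (hy : 0 < y) :
    (x ^ 2 - y ^ 2) * sinh y ≤ 2 * y * (cosh x - cosh y) := by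
  set F : ℝ → ℝ := fun x => 2 * y * (cosh x - cosh y) - (x ^ 2 - y ^ 2) * sinh y with hF
  have hd : ∀ t, HasDerivAt F (2 * y * sinh t - 2 * t * sinh y) t := by
    intro t
    have := (((hasDerivAt_cosh t).sub_const (cosh y)).const_mul (2 * y)).sub
      (((hasDerivAt_pow 2 t).sub_const (y ^ 2)).mul_const (sinh y))
    refine this.congr_deriv ?_
    simp
  have key : F y ≤ F x := by
    rcases le_total x y with h | h
    · have : AntitoneOn F (Set.Icc 0 y) := by
        apply antitoneOn_of_deriv_nonpos (convex_Icc 0 y)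
        · exact fun x _ => (hd x).continuousAt.continuousWithinAt
        · exact fun x _ => (hd x).differentiableAt.differentiableWithinAt
        · intro t ht
          rw [interior_Icc] at ht
          rw [(hd t).deriv]
          have := sinh_div_mono ht.1.le ht.2.le
          linarith
      exact this ⟨hx, h⟩ ⟨hy.le, le_rfl⟩ h
    · have : MonotoneOn F (Set.Ici y) := by
        apply monotoneOn_of_deriv_nonneg (convex_Ici y)
        · exact fun x _ => (hd x).continuousAt.continuousWithinAt
        · exact fun x _ => (hd x).differentiableAt.differentiableWithinAt
        · intro t ht
          rw [interior_Ici] at ht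
          rw [(hd t).deriv]
          have := sinh_div_mono hy.le (le_of_lt ht)
          linarith
      exact this (Set.mem_Ici.mpr le_rfl) h h
  simp only [hF] at key
  linarith

lemma two_cosh_sub {b : ℝ} (hb : 0 ≤ b) : 2 * (cosh b - 1) ≤ b * sinh b := by
  have h := sinh_le_mul_cosh (w := b / 2) (by linarith)
  have h1 : cosh b = 1 + 2 * sinh (b / 2) ^ 2 := by
    have := cosh_two_mul (b / 2)
    rw [show 2 * (b / 2) = b by ring, cosh_sq] at this
    linarith
  have h2 : sinh b = 2 * sinh (b / 2) * cosh (b / 2) := by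
    have := sinh_two_mul (b / 2)
    rwa [show 2 * (b / 2) = b by ring] at this
  have h3 : 0 ≤ sinh (b / 2) := sinh_nonneg_iff.mpr (by linarith)
  rw [h1, h2]
  nlinarith

lemma antitone_of_deriv_le {g g' : ℝ → ℝ} (hd : ∀ t, HasDerivAt g (g' t) t)
    (h : ∀ t, 0 ≤ t → g' t ≤ 0) {t : ℝ} (ht : 0 ≤ t) : g t ≤ g 0 := by
  have : AntitoneOn g (Set.Ici 0) := by
    apply antitoneOn_of_deriv_nonpos (convex_Ici 0)
    · exact fun x _ => (hd x).continuousAt.continuousWithinAt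
    · exact fun x _ => (hd x).differentiableAt.differentiableWithinAt
    · intro t ht
      rw [interior_Ici] at ht
      rw [(hd t).deriv]
      exact h t (le_of_lt ht)
  exact this (Set.mem_Ici.mpr le_rfl) ht ht

lemma ode_compare {κ : ℝ} {g g' g'' : ℝ → ℝ} (hd : ∀ t, HasDerivAt g (g' t) t)
    (hd' : ∀ t, HasDerivAt g' (g'' t) t) (h : ∀ t, g'' t ≤ κ ^ 2 * g t)
    (h0 : g 0 ≤ 0) (h0' : g' 0 - κ * g 0 ≤ 0) {t : ℝ} (ht : 0 ≤ t) : g t ≤ 0 := by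
  have he : ∀ c t : ℝ, HasDerivAt (fun t => exp (c * t)) (c * exp (c * t)) t := by
    intro c t
    have := ((hasDerivAt_id t).const_mul c).exp
    refine this.congr_deriv ?_
    simp [mul_comm]
  have h1 : ∀ t, 0 ≤ t → g' t - κ * g t ≤ 0 := by
    intro t ht
    have := antitone_of_deriv_le (g := fun t => exp (κ * t) * (g' t - κ * g t))
      (g' := fun t => (κ * exp (κ * t)) * (g' t - κ * g t) +
        exp (κ * t) * (g'' t - κ * g' t))
      (fun t => (he κ t).mul ((hd' t).sub ((hd t).const_mul κ)))
      (fun t _ => by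
        have h2 := h t
        have h3 := exp_pos (κ * t)
        have : κ * exp (κ * t) * (g' t - κ * g t) + exp (κ * t) * (g'' t - κ * g' t) =
          exp (κ * t) * (g'' t - κ ^ 2 * g t) := by ring
        rw [this]
        exact mul_nonpos_of_nonneg_of_nonpos h3.le (by linarith)) ht
    simp only [mul_zero, exp_zero, one_mul] at this
    have h3 := exp_pos (κ * t)
    by_contra hc
    push Not at hc
    have := mul_pos h3 hc
    linarith
  have := antitone_of_deriv_le (g := fun t => exp (-κ * t) * g t)
      (g' := fun t => (-κ * exp (-κ * t)) * g t + exp (-κ * t) * g' t)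
      (fun t => (he (-κ) t).mul (hd t))
      (fun t ht => by
        have h2 := h1 t ht
        have h3 := exp_pos (-κ * t)
        have : -κ * exp (-κ * t) * g t + exp (-κ * t) * g' t =
          exp (-κ * t) * (g' t - κ * g t) := by ring
        rw [this]
        exact mul_nonpos_of_nonneg_of_nonpos h3.le h2) ht
  simp only [mul_zero, exp_zero, one_mul] at this
  have h3 := exp_pos (-κ * t)
  by_contra hc
  push Not at hc
  have := mul_pos h3 hc
  linarith

noncomputable def lam (x y : ℝ) : ℝ :=
  ∫ s in (0:ℝ)..1, (1 + s * (x - 1))⁻¹ * (1 + s * (y - 1))⁻¹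

lemma seg_pos {x s : ℝ} (hx : 0 < x) (hs : s ∈ Set.Icc (0:ℝ) 1) : 0 < 1 + s * (x - 1) := by
  obtain ⟨h0, h1⟩ := hs
  rcases h0.eq_or_lt with rfl | h0
  · simp
  · nlinarith [mul_pos h0 hx]

lemma lam_cont {x y : ℝ} (hx : 0 < x) (hy : 0 < y) :
    ContinuousOn (fun s => (1 + s * (x - 1))⁻¹ * (1 + s * (y - 1))⁻¹) (Set.uIcc (0:ℝ) 1) := by
  rw [Set.uIcc_of_le zero_le_one]
  apply ContinuousOn.mul
  · exact ContinuousOn.inv₀ (by fun_prop) fun s hs => (seg_pos hx hs).ne'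
  · exact ContinuousOn.inv₀ (by fun_prop) fun s hs => (seg_pos hy hs).ne'

lemma hasDeriv_seg (x s : ℝ) : HasDerivAt (fun s => 1 + s * (x - 1)) (x - 1) s := by
  have := ((hasDerivAt_id s).mul_const (x - 1)).const_add 1
  simpa using this

lemma lam_mul {x y : ℝ} (hx : 0 < x) (hy : 0 < y) :
    (x - y) * lam x y = Real.log x - Real.log y := by
  unfold lam
  rw [← intervalIntegral.integral_const_mul]
  rw [intervalIntegral.integral_eq_sub_of_hasDerivAt
    (f := fun s => Real.log (1 + s * (x - 1)) - Real.log (1 + s * (y - 1)))]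
  · simp
  · intro s hs
    rw [Set.uIcc_of_le zero_le_one] at hs
    have h1 := (seg_pos hx hs).ne'
    have h2 := (seg_pos hy hs).ne'
    refine (((hasDeriv_seg x s).log h1).sub ((hasDeriv_seg y s).log h2)).congr_deriv ?_
    rw [div_sub_div _ _ h1 h2, div_eq_mul_inv, mul_inv]
    ring
  · exact ((lam_cont hx hy).const_smul (x - y)).intervalIntegrable

lemma lam_self {x : ℝ} (hx : 0 < x) : lam x x = x⁻¹ := by
  unfold lam
  rw [intervalIntegral.integral_eq_sub_of_hasDerivAt (f := fun s => s / (1 + s * (x - 1)))]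
  · simp
  · intro s hs
    rw [Set.uIcc_of_le zero_le_one] at hs
    have h1 := (seg_pos hx hs).ne'
    refine ((hasDerivAt_id s).div (hasDeriv_seg x s) h1).congr_deriv ?_
    simp only [id]
    field_simp
    ring
  · exact (lam_cont hx hx).intervalIntegrable

lemma lam_comm (x y : ℝ) : lam x y = lam y x := by
  unfold lam; simp only [mul_comm]

lemma lam_eq {x y : ℝ} (hx : 0 < x) (hy : 0 < y) (h : y < x) :
    lam x y * ((x + y) / 2) = ((Real.log x - Real.log y) / 2) *
      cosh ((Real.log x - Real.log y) / 2) / sinh ((Real.log x - Real.log y) / 2) := by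
  obtain ⟨a, rfl⟩ : ∃ a, x = exp a := ⟨Real.log x, (exp_log hx).symm⟩
  obtain ⟨b, rfl⟩ : ∃ b, y = exp b := ⟨Real.log y, (exp_log hy).symm⟩
  have hm := lam_mul hx hy
  simp only [log_exp] at hm ⊢
  have hab : b < a := exp_lt_exp.mp h
  set w := (a - b) / 2 with hw
  set m := (a + b) / 2 with hmm
  have ha : exp a = exp m * exp w := by rw [← exp_add]; congr 1; ring
  have hb : exp b = exp m * exp (-w) := by rw [← exp_add]; congr 1; ring
  have hs : 0 < sinh w := sinh_pos_iff.mpr (by rw [hw]; linarith)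
  have e1 : exp a - exp b = exp m * 2 * sinh w := by rw [ha, hb, sinh_eq]; ring
  have e2 : (exp a + exp b) / 2 = exp m * cosh w := by rw [ha, hb, cosh_eq]; ring
  rw [e1] at hm
  rw [e2, eq_div_iff hs.ne']
  have : w = exp m * sinh w * lam (exp a) (exp b) := by
    have : a - b = 2 * w := by rw [hw]; ring
    linarith
  linear_combination (-(cosh w)) * this

lemma lam_lower {x y : ℝ} (hx : 0 < x) (hy : 0 < y) : 1 ≤ lam x y * ((x + y) / 2) := by
  wlog h : y ≤ x generalizing x y
  · rw [lam_comm, add_comm]; exact this hy hx (by linarith)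
  rcases h.eq_or_lt with rfl | h
  · rw [lam_self hx]; apply le_of_eq; field_simp; norm_num
  rw [lam_eq hx hy h]
  have hw : 0 < (Real.log x - Real.log y) / 2 := by
    have := Real.log_lt_log hy h; linarith
  rw [le_div_iff₀ (sinh_pos_iff.mpr hw), one_mul]
  exact sinh_le_mul_cosh hw.le

lemma one_le_xcoth {z : ℝ} (hz : 0 < z) : 1 ≤ z * cosh z / sinh z := by
  rw [le_div_iff₀ (sinh_pos_iff.mpr hz), one_mul]
  exact sinh_le_mul_cosh hz.le

lemma lam_upper {x y z : ℝ} (hx : 0 < x) (hy : 0 < y) (hz : 0 < z)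
    (h : |Real.log x - Real.log y| ≤ 2 * z) :
    lam x y * ((x + y) / 2) ≤ z * cosh z / sinh z := by
  wlog hxy : y ≤ x generalizing x y
  · rw [lam_comm, add_comm]; exact this hy hx (by rwa [abs_sub_comm]) (by linarith)
  rcases hxy.eq_or_lt with rfl | hxy
  · rw [lam_self hx]; refine le_trans (le_of_eq ?_) (one_le_xcoth hz); field_simp; norm_num
  rw [lam_eq hx hy hxy]
  have hw : 0 < (Real.log x - Real.log y) / 2 := by
    have := Real.log_lt_log hy hxy; linarith
  apply xcoth_mono hw
  have := (abs_le.mp h).2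
  linarith

end SPD

namespace SPD

variable {n : ℕ}

lemma posDef_congr {W R : Matrix (Fin n) (Fin n) ℝ} (hW : W.PosDef) (hR : IsUnit R) :
    (R * W * Rᵀ).PosDef := by
  have := (IsUnit.posDef_star_right_conjugate_iff hR (x := W)).mpr hW
  rwa [star_eq_conjTranspose, conjTranspose_eq_transpose_of_trivial] at this

lemma evec_unit (A : Matrix (Fin n) (Fin n) ℝ) : IsUnit (evec A) :=
  IsUnit.of_mul_eq_one _ (evec_mt A)

lemma mfun_posDef {A : Matrix (Fin n) (Fin n) ℝ} (hA : A.IsHermitian) {f : ℝ → ℝ}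
    (h : ∀ i, 0 < f (eigs A i)) : (mfun A f).PosDef := by
  rw [mfun_eq hA]
  exact posDef_congr (PosDef.diagonal h) (evec_unit A)

lemma dmat_lam {A C : Matrix (Fin n) (Fin n) ℝ} (hA : A.PosDef) (hC : C.PosDef)
    (X : Matrix (Fin n) (Fin n) ℝ) (i j : Fin n) :
    dmat A C X lam i j = ∫ s in (0:ℝ)..1, (mfun A (fun x => (1 + s * (x - 1))⁻¹) * X *
      mfun C (fun x => (1 + s * (x - 1))⁻¹)) i j := by
  have : ∀ s : ℝ, (mfun A (fun x => (1 + s * (x - 1))⁻¹) * X *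
      mfun C (fun x => (1 + s * (x - 1))⁻¹)) i j =
      ∑ l, ∑ k, ((1 + s * (eigs A k - 1))⁻¹ * (1 + s * (eigs C l - 1))⁻¹) *
      (evec A i k * ((evec A)ᵀ * X * evec C) k l * evec C j l) := by
    intro s
    rw [← dmat_prod hA.1 hC.1, dmat_apply]
  simp only [this]
  have hInt : ∀ k l, IntervalIntegrable (fun s : ℝ =>
      ((1 + s * (eigs A k - 1))⁻¹ * (1 + s * (eigs C l - 1))⁻¹) *
      (evec A i k * ((evec A)ᵀ * X * evec C) k l * evec C j l)) MeasureTheory.volume 0 1 := by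
    intro k l
    exact ((lam_cont (eigs_pos hA k) (eigs_pos hC l)).mul continuousOn_const).intervalIntegrable
  rw [intervalIntegral.integral_finsetSum]
  · rw [dmat_apply]
    refine Finset.sum_congr rfl fun l _ => ?_
    rw [intervalIntegral.integral_finsetSum]
    · refine Finset.sum_congr rfl fun k _ => ?_
      rw [intervalIntegral.integral_mul_const, lam]
    · exact fun k _ => hInt k l
  · intro l _
    have := IntervalIntegrable.sum Finset.univ (fun k _ => hInt k l)
    refine this.congr ?_
    intro s _
    simp [Finset.sum_apply]

lemma resolvent {A : Matrix (Fin n) (Fin n) ℝ} (hA : A.PosDef) {s : ℝ}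
    (hs : s ∈ Set.Icc (0:ℝ) 1) :
    (1 + s • (A - 1)) * mfun A (fun x => (1 + s * (x - 1))⁻¹) = 1 := by
  have e : 1 + s • (A - 1) = mfun A (fun x => 1 + s * (x - 1)) := by
    have h1 := evec_mt A
    have : diagonal (fun i => 1 + s * (eigs A i - 1)) = 1 + s • (diagonal (eigs A) - 1) := by
      ext i j
      by_cases hij : i = j
      · subst hij; simp
      · simp [hij]
    rw [mfun_eq hA.1, this, Matrix.mul_add, Matrix.add_mul, Matrix.mul_one, h1]
    congr 1
    rw [Matrix.mul_smul, Matrix.smul_mul, Matrix.mul_sub, Matrix.sub_mul, Matrix.mul_one, h1,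
      ← spec hA.1]
  rw [e, mfun_mul hA.1, ← mfun_one hA.1]
  apply mfun_congr
  intro i
  exact mul_inv_cancel₀ (seg_pos (eigs_pos hA i) hs).ne'

lemma resolvent_inv {A : Matrix (Fin n) (Fin n) ℝ} (hA : A.PosDef) {s : ℝ}
    (hs : s ∈ Set.Icc (0:ℝ) 1) :
    (1 + s • (A - 1))⁻¹ = mfun A (fun x => (1 + s * (x - 1))⁻¹) :=
  Matrix.inv_eq_right_inv (resolvent hA hs)

lemma hasDeriv_log {M : ℝ → Matrix (Fin n) (Fin n) ℝ} {H : Matrix (Fin n) (Fin n) ℝ} {t : ℝ}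
    (hpos : ∀ τ, (M τ).PosDef) (hcont : Continuous M)
    (hder : ∀ i j, HasDerivAt (fun τ => M τ i j) (H i j) t) (i j : Fin n) :
    HasDerivAt (fun τ => mfun (M τ) Real.log i j) (dmat (M t) (M t) H lam i j) t := by
  set cl : ℝ → ℝ := fun s => max 0 (min 1 s) with hcl
  have hclm : ∀ s, cl s ∈ Set.Icc (0:ℝ) 1 := fun s =>
    ⟨le_max_left _ _, max_le zero_le_one (min_le_left _ _)⟩
  have hcle : ∀ s ∈ Set.Icc (0:ℝ) 1, cl s = s := fun s hs => by
    simp [hcl, hs.1, hs.2]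
  have hclc : Continuous cl := by fun_prop
  set Δ : ℝ → Matrix (Fin n) (Fin n) ℝ := fun τ =>
    Matrix.of fun i j => dslope (fun τ => M τ i j) t τ with hΔ
  have hMe : ∀ i j, Continuous (fun τ => M τ i j) := fun i j => hcont.matrix_elem i j
  have hΔc : Continuous Δ := by
    apply continuous_matrix
    intro i j
    simp only [hΔ, of_apply]
    rw [continuous_iff_continuousAt]
    intro τ
    by_cases h : τ = t
    · subst h
      exact continuousAt_dslope_same.mpr (hder i j).differentiableAt
    · exact (continuousAt_dslope_of_ne h).mpr (hMe i j).continuousAt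
  set Res : ℝ → ℝ → Matrix (Fin n) (Fin n) ℝ := fun τ s => (1 + cl s • (M τ - 1))⁻¹ with hRes
  have hResc : Continuous (fun q : ℝ × ℝ => Res q.1 q.2) := by
    have hc : Continuous (fun q : ℝ × ℝ => 1 + cl q.2 • (M q.1 - 1)) := by
      have h1 : Continuous (fun q : ℝ × ℝ => M q.1) := hcont.comp continuous_fst
      have h2 : Continuous (fun q : ℝ × ℝ => cl q.2) := hclc.comp continuous_snd
      exact continuous_const.add (h2.smul (h1.sub continuous_const))
    simp only [hRes, Matrix.inv_def, Ring.inverse_eq_inv']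
    refine Continuous.smul (Continuous.inv₀ hc.matrix_det ?_) hc.matrix_adjugate
    intro q hq
    have h1 := resolvent (hpos q.1) (hclm q.2)
    have h2 := congrArg Matrix.det h1
    rw [det_mul, hq, zero_mul, det_one] at h2
    exact zero_ne_one h2
  have hIc : Continuous (fun τ => ∫ s in (0:ℝ)..1, (Res τ s * Δ τ * Res t s) i j) := by
    apply intervalIntegral.continuous_parametric_intervalIntegral_of_continuous'
    have h1 : Continuous (fun q : ℝ × ℝ => Δ q.1) := hΔc.comp continuous_fst
    have h2 : Continuous (fun q : ℝ × ℝ => Res t q.2) :=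
      hResc.comp (continuous_const.prodMk continuous_snd)
    exact ((hResc.matrix_mul h1).matrix_mul h2).matrix_elem i j
  have hI : ∀ τ, ∫ s in (0:ℝ)..1, (Res τ s * Δ τ * Res t s) i j =
      dmat (M τ) (M t) (Δ τ) lam i j := by
    intro τ
    rw [dmat_lam (hpos τ) (hpos t)]
    apply intervalIntegral.integral_congr
    intro s hs
    rw [Set.uIcc_of_le zero_le_one] at hs
    simp only [hRes]
    rw [hcle s hs, resolvent_inv (hpos τ) hs, resolvent_inv (hpos t) hs]
  rw [hasDerivAt_iff_tendsto_slope]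
  have hlim : Tendsto (fun τ => dmat (M τ) (M t) (Δ τ) lam i j) (nhdsWithin t {t}ᶜ)
      (nhds (dmat (M t) (M t) H lam i j)) := by
    have hΔt : Δ t = H := by
      ext i j
      simp only [hΔ, of_apply, dslope_same]
      exact (hder i j).deriv
    have := (hIc.tendsto t)
    simp only [hI] at this
    rw [hΔt] at this
    exact this.mono_left nhdsWithin_le_nhds
  refine hlim.congr' ?_
  filter_upwards [self_mem_nhdsWithin] with τ hτ
  have hτ : τ ≠ t := hτ
  have h0 : τ - t ≠ 0 := sub_ne_zero.mpr hτ
  have hMd : M τ - M t = (τ - t) • Δ τ := by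
    ext i j
    simp only [hΔ, Matrix.sub_apply, Matrix.smul_apply, of_apply, smul_eq_mul]
    rw [dslope_of_ne _ hτ, slope_def_field]
    field_simp
  have h1 : mfun (M τ) Real.log - mfun (M t) Real.log = dmat (M τ) (M t) (M τ - M t) lam := by
    rw [dmat_log (hpos τ).1 (hpos t).1, dmat_diff (hpos τ).1 (hpos t).1]
    ext i j
    rw [dmat_apply, dmat_apply]
    refine Finset.sum_congr rfl fun l _ => Finset.sum_congr rfl fun k _ => ?_
    rw [lam_mul (eigs_pos (hpos τ) k) (eigs_pos (hpos t) l)]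
  have h2 : dmat (M τ) (M t) (M τ - M t) lam = (τ - t) • dmat (M τ) (M t) (Δ τ) lam := by
    rw [hMd]
    ext i j
    simp only [dmat_apply, Matrix.smul_apply, Matrix.mul_smul, Matrix.smul_mul, smul_eq_mul,
      Finset.mul_sum]
    refine Finset.sum_congr rfl fun l _ => Finset.sum_congr rfl fun k _ => ?_
    ring
  rw [slope_def_field, ← Matrix.sub_apply, h1, h2, Matrix.smul_apply, smul_eq_mul]
  field_simp

end SPD

namespace SPD

variable {n : ℕ}

lemma trace_conj (V X : Matrix (Fin n) (Fin n) ℝ) (hV : V * Vᵀ = 1) :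
    (Vᵀ * X * V).trace = X.trace := by
  rw [trace_mul_comm, ← Matrix.mul_assoc, hV, Matrix.one_mul]

lemma conj_mul (V X Y : Matrix (Fin n) (Fin n) ℝ) (hV : V * Vᵀ = 1) :
    Vᵀ * (X * Y) * V = (Vᵀ * X * V) * (Vᵀ * Y * V) := by
  calc _ = Vᵀ * X * (1 * (Y * V)) := by simp only [Matrix.mul_assoc, Matrix.one_mul]
    _ = _ := by rw [← hV]; simp only [Matrix.mul_assoc]

lemma conj_mfun {A : Matrix (Fin n) (Fin n) ℝ} (hA : A.IsHermitian) (f : ℝ → ℝ) :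
    (evec A)ᵀ * mfun A f * evec A = diagonal (fun i => f (eigs A i)) := by
  rw [mfun_eq hA]
  calc _ = ((evec A)ᵀ * evec A) * diagonal (fun i => f (eigs A i)) * ((evec A)ᵀ * evec A) := by
        simp only [Matrix.mul_assoc]
    _ = _ := by rw [evec_tm, Matrix.one_mul, Matrix.mul_one]

lemma conj_dmat (A X : Matrix (Fin n) (Fin n) ℝ) (F : ℝ → ℝ → ℝ) :
    (evec A)ᵀ * dmat A A X F * evec A =
      Matrix.of (fun k l => F (eigs A k) (eigs A l) * ((evec A)ᵀ * X * evec A) k l) := by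
  unfold dmat
  generalize Matrix.of (fun k l => F (eigs A k) (eigs A l) * ((evec A)ᵀ * X * evec A) k l) = Y
  calc _ = ((evec A)ᵀ * evec A) * Y * ((evec A)ᵀ * evec A) := by
        simp only [Matrix.mul_assoc]
    _ = _ := by rw [evec_tm, Matrix.one_mul, Matrix.mul_one]

section static
variable {M N : Matrix (Fin n) (Fin n) ℝ}

lemma st_H (hM : M.PosDef) (i j : Fin n) : ((evec M)ᵀ * (M * N) * evec M) i j =
    eigs M i * ((evec M)ᵀ * N * evec M) i j := by
  rw [conj_mul _ _ _ (evec_mt M)]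
  have := conj_mfun hM.1 (fun x => x)
  rw [mfun_id hM.1] at this
  rw [this, diagonal_mul]

lemma st_tr (hM : M.PosDef) (f : ℝ → ℝ) : (mfun M f * N).trace =
    ∑ i, f (eigs M i) * ((evec M)ᵀ * N * evec M) i i := by
  rw [← trace_conj _ _ (evec_mt M), conj_mul _ _ _ (evec_mt M), conj_mfun hM.1]
  simp [Matrix.trace, diagonal_mul]

lemma st_NN (hM : M.PosDef) : (N * N).trace =
    ∑ i, ∑ j, ((evec M)ᵀ * N * evec M) i j * ((evec M)ᵀ * N * evec M) j i := by
  rw [← trace_conj _ _ (evec_mt M), conj_mul _ _ _ (evec_mt M)]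
  simp [Matrix.trace, Matrix.mul_apply]

lemma st_DN (hM : M.PosDef) (F : ℝ → ℝ → ℝ) : (dmat M M (M * N) F * N).trace =
    ∑ i, ∑ j, F (eigs M i) (eigs M j) * eigs M i *
      (((evec M)ᵀ * N * evec M) i j * ((evec M)ᵀ * N * evec M) j i) := by
  rw [← trace_conj _ _ (evec_mt M), conj_mul _ _ _ (evec_mt M), conj_dmat]
  rw [Matrix.trace]
  refine Finset.sum_congr rfl fun i _ => ?_
  rw [diag_apply, Matrix.mul_apply]
  refine Finset.sum_congr rfl fun j _ => ?_
  rw [of_apply, st_H hM]; ring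

lemma st_LD (hM : M.PosDef) : (mfun M Real.log * dmat M M (M * N) lam).trace =
    (mfun M Real.log * N).trace := by
  rw [st_tr hM, ← trace_conj _ _ (evec_mt M), conj_mul _ _ _ (evec_mt M), conj_dmat, conj_mfun hM.1]
  rw [Matrix.trace]
  refine Finset.sum_congr rfl fun i _ => ?_
  rw [diag_apply, diagonal_mul, of_apply, st_H hM, lam_self (eigs_pos hM i)]
  have := (eigs_pos hM i).ne'
  field_simp


lemma st_sym (hM : M.PosDef) (hs : (M * N)ᵀ = M * N) (i j : Fin n) : eigs M i * ((evec M)ᵀ * N * evec M) i j =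
    eigs M j * ((evec M)ᵀ * N * evec M) j i := by
  rw [← st_H hM, ← st_H hM]
  have : ((evec M)ᵀ * (M * N) * evec M)ᵀ = (evec M)ᵀ * (M * N) * evec M := by
    rw [transpose_mul, transpose_mul, transpose_transpose, hs]
    simp only [Matrix.mul_assoc]
  conv_lhs => rw [← this]
  rw [transpose_apply]

lemma st_a_nonneg (hM : M.PosDef) (hs : (M * N)ᵀ = M * N) (i j : Fin n) :
    0 ≤ ((evec M)ᵀ * N * evec M) i j * ((evec M)ᵀ * N * evec M) j i := by
  have h := st_sym hM hs i j
  have hi := eigs_pos hM i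
  have hj := eigs_pos hM j
  set x := ((evec M)ᵀ * N * evec M) i j
  set y := ((evec M)ᵀ * N * evec M) j i
  have : eigs M j * (x * y) = eigs M i * x ^ 2 := by
    calc _ = x * (eigs M j * y) := by ring
      _ = _ := by rw [← h]; ring
  by_contra hc
  push Not at hc
  have h1 := mul_neg_of_pos_of_neg hj hc
  have h2 := mul_nonneg hi.le (sq_nonneg x)
  linarith

lemma st_h (hM : M.PosDef) (hs : (M * N)ᵀ = M * N) : (dmat M M (M * N) lam * N).trace =
    ∑ i, ∑ j, lam (eigs M i) (eigs M j) * ((eigs M i + eigs M j) / 2) *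
      (((evec M)ᵀ * N * evec M) i j * ((evec M)ᵀ * N * evec M) j i) := by
  rw [st_DN hM]
  have h : ∑ i, ∑ j, lam (eigs M i) (eigs M j) * eigs M i *
      (((evec M)ᵀ * N * evec M) i j * ((evec M)ᵀ * N * evec M) j i) =
     ∑ i, ∑ j, lam (eigs M i) (eigs M j) * eigs M j *
      (((evec M)ᵀ * N * evec M) i j * ((evec M)ᵀ * N * evec M) j i) := by
    rw [Finset.sum_comm]
    refine Finset.sum_congr rfl fun i _ => Finset.sum_congr rfl fun j _ => ?_
    rw [lam_comm]; ring
  have h2 : ∑ i, ∑ j, lam (eigs M i) (eigs M j) * ((eigs M i + eigs M j) / 2) *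
      (((evec M)ᵀ * N * evec M) i j * ((evec M)ᵀ * N * evec M) j i) =
      (1 / 2) * ∑ i, ∑ j, lam (eigs M i) (eigs M j) * eigs M i *
      (((evec M)ᵀ * N * evec M) i j * ((evec M)ᵀ * N * evec M) j i) +
      (1 / 2) * ∑ i, ∑ j, lam (eigs M i) (eigs M j) * eigs M j *
      (((evec M)ᵀ * N * evec M) i j * ((evec M)ᵀ * N * evec M) j i) := by
    simp only [Finset.mul_sum, ← Finset.sum_add_distrib]
    refine Finset.sum_congr rfl fun i _ => Finset.sum_congr rfl fun j _ => ?_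
    ring
  rw [h2, ← h]; ring

lemma st_lower (hM : M.PosDef) (hs : (M * N)ᵀ = M * N) : (N * N).trace ≤ (dmat M M (M * N) lam * N).trace := by
  rw [st_h hM hs, st_NN hM]
  refine Finset.sum_le_sum fun i _ => Finset.sum_le_sum fun j _ => ?_
  exact le_mul_of_one_le_left (st_a_nonneg hM hs i j) (lam_lower (eigs_pos hM i) (eigs_pos hM j))

lemma st_upper (hM : M.PosDef) (hs : (M * N)ᵀ = M * N) {E z : ℝ} (hE : 0 < E) (hz : z = khat * E)
    (hy : ∑ i, (Real.log (eigs M i)) ^ 2 ≤ E ^ 2) :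
    (dmat M M (M * N) lam * N).trace ≤ (mfun M Real.log * N).trace ^ 2 / E ^ 2 +
      z * cosh z / sinh z * ((N * N).trace - (mfun M Real.log * N).trace ^ 2 / E ^ 2) := by
  have hk : 0 < khat := by unfold khat; positivity
  have hk2 : khat ^ 2 = 1 / 2 := by unfold khat; rw [inv_pow, Real.sq_sqrt (by norm_num)]; norm_num
  have hz0 : 0 < z := by rw [hz]; positivity
  set ζ := z * cosh z / sinh z with hζ
  have hζ1 : 1 ≤ ζ := one_le_xcoth hz0
  set a : Fin n → Fin n → ℝ := fun i j =>
    ((evec M)ᵀ * N * evec M) i j * ((evec M)ᵀ * N * evec M) j i with ha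
  have ha0 : ∀ i j, 0 ≤ a i j := st_a_nonneg hM hs
  have hG : (mfun M Real.log * N).trace ^ 2 / E ^ 2 ≤ ∑ i, a i i := by
    rw [div_le_iff₀ (by positivity), st_tr hM]
    have cs := Finset.sum_mul_sq_le_sq_mul_sq Finset.univ (fun i => Real.log (eigs M i))
      (fun i => ((evec M)ᵀ * N * evec M) i i)
    have h1 : ∑ i, a i i = ∑ i, ((evec M)ᵀ * N * evec M) i i ^ 2 :=
      Finset.sum_congr rfl fun i _ => by simp only [ha]; ring
    rw [h1, mul_comm]
    exact cs.trans (mul_le_mul_of_nonneg_right hy (Finset.sum_nonneg fun i _ => sq_nonneg _))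
  have hterm : ∀ i j, lam (eigs M i) (eigs M j) * ((eigs M i + eigs M j) / 2) * a i j ≤
      ζ * a i j - (ζ - 1) * (if i = j then a i i else 0) := by
    intro i j
    by_cases hij : i = j
    · subst hij
      rw [lam_self (eigs_pos hM i)]
      have := (eigs_pos hM i).ne'
      apply le_of_eq
      simp only [if_true]
      field_simp
      ring
    · rw [if_neg hij, mul_zero, sub_zero]
      apply mul_le_mul_of_nonneg_right _ (ha0 i j)
      apply lam_upper (eigs_pos hM i) (eigs_pos hM j) hz0
      have hsum : Real.log (eigs M i) ^ 2 + Real.log (eigs M j) ^ 2 ≤ E ^ 2 := by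
        refine le_trans ?_ hy
        rw [← Finset.sum_pair hij (f := fun i => Real.log (eigs M i) ^ 2)]
        exact Finset.sum_le_sum_of_subset_of_nonneg (Finset.subset_univ _)
          fun _ _ _ => sq_nonneg _
      apply abs_le_of_sq_le_sq _ (by positivity)
      rw [hz, mul_pow, mul_pow, hk2]
      nlinarith [sq_nonneg (Real.log (eigs M i) + Real.log (eigs M j))]
  have hsum : (dmat M M (M * N) lam * N).trace ≤ ζ * (N * N).trace - (ζ - 1) * ∑ i, a i i := by
    rw [st_h hM hs, st_NN hM]
    refine (Finset.sum_le_sum fun i _ => Finset.sum_le_sum fun j _ => hterm i j).trans ?_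
    apply le_of_eq
    simp only [Finset.sum_sub_distrib, ← Finset.mul_sum, Finset.sum_ite_eq, Finset.mem_univ, if_true, ha]
  nlinarith [mul_le_mul_of_nonneg_left hG (sub_nonneg.mpr hζ1)]

end static

end SPD

namespace SPD

variable {n : ℕ}

noncomputable def Mc (B R : Matrix (Fin n) (Fin n) ℝ) (τ : ℝ) : Matrix (Fin n) (Fin n) ℝ :=
  R * mfun B (fun x => Real.exp (τ * x)) * Rᵀ

noncomputable def yc (B R : Matrix (Fin n) (Fin n) ℝ) (τ : ℝ) : ℝ :=
  ∑ i, (Real.log (eigs (Mc B R τ) i)) ^ 2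

noncomputable def Nc (B R : Matrix (Fin n) (Fin n) ℝ) : Matrix (Fin n) (Fin n) ℝ :=
  (R⁻¹)ᵀ * B * Rᵀ

noncomputable def Gc (B R : Matrix (Fin n) (Fin n) ℝ) (τ : ℝ) : ℝ :=
  (mfun (Mc B R τ) Real.log * Nc B R).trace

noncomputable def hc (B R : Matrix (Fin n) (Fin n) ℝ) (τ : ℝ) : ℝ :=
  (dmat (Mc B R τ) (Mc B R τ) (Mc B R τ * Nc B R) lam * Nc B R).trace

lemma sandwich_apply {B : Matrix (Fin n) (Fin n) ℝ} (hB : B.IsHermitian)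
    (R : Matrix (Fin n) (Fin n) ℝ) (f : ℝ → ℝ) (i j : Fin n) :
    (R * mfun B f * Rᵀ) i j =
      ∑ k, f (eigs B k) * ((R * evec B) i k * (R * evec B) j k) := by
  rw [mfun_eq hB]
  have : R * (evec B * diagonal (fun i => f (eigs B i)) * (evec B)ᵀ) * Rᵀ =
      (R * evec B) * diagonal (fun i => f (eigs B i)) * (R * evec B)ᵀ := by
    rw [transpose_mul]; simp only [Matrix.mul_assoc]
  rw [this, Matrix.mul_apply]
  refine Finset.sum_congr rfl fun k _ => ?_
  rw [mul_diagonal, transpose_apply]; ring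

section dyn
variable {B R : Matrix (Fin n) (Fin n) ℝ}

lemma Mc_pos (hB : B.IsHermitian) (hR : IsUnit R) (τ : ℝ) : (Mc B R τ).PosDef :=
  posDef_congr (mfun_posDef hB fun i => exp_pos _) hR

lemma Mc_cont (hB : B.IsHermitian) (hR : IsUnit R) : Continuous (Mc B R) := by
  apply continuous_matrix
  intro i j
  simp only [Mc, sandwich_apply hB]
  fun_prop

lemma Mc_N (hB : B.IsHermitian) (hR : IsUnit R) (τ : ℝ) : Mc B R τ * Nc B R = R * mfun B (fun x => x * Real.exp (τ * x)) * Rᵀ := by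
  have h1 : Rᵀ * (R⁻¹)ᵀ = 1 := by
    rw [← transpose_mul, Matrix.nonsing_inv_mul _ ((Matrix.isUnit_iff_isUnit_det R).mp hR),
      transpose_one]
  have h2 : mfun B (fun x => x * Real.exp (τ * x)) = mfun B (fun x => Real.exp (τ * x)) * B := by
    have h3 := mfun_mul hB (fun x => Real.exp (τ * x)) (fun x => x)
    rw [mfun_id hB] at h3
    rw [h3]
    exact mfun_congr _ _ fun i => mul_comm _ _
  rw [Mc, Nc, h2]
  calc _ = R * mfun B (fun x => Real.exp (τ * x)) * (Rᵀ * (R⁻¹)ᵀ) * B * Rᵀ := by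
        simp only [Matrix.mul_assoc]
    _ = _ := by rw [h1, Matrix.mul_one]; simp only [Matrix.mul_assoc]

lemma Mc_sym (hB : B.IsHermitian) (hR : IsUnit R) (τ : ℝ) : (Mc B R τ * Nc B R)ᵀ = Mc B R τ * Nc B R := by
  rw [Mc_N hB hR, transpose_mul, transpose_mul, mfun_tr, transpose_transpose, Matrix.mul_assoc]

lemma Mc_der (hB : B.IsHermitian) (hR : IsUnit R) (τ : ℝ) (i j : Fin n) :
    HasDerivAt (fun τ => Mc B R τ i j) ((Mc B R τ * Nc B R) i j) τ := by
  rw [Mc_N hB hR]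
  simp only [Mc, sandwich_apply hB]
  apply HasDerivAt.fun_sum
  intro k _
  apply HasDerivAt.mul_const
  have := ((hasDerivAt_id τ).mul_const (eigs B k)).exp
  refine this.congr_deriv ?_
  simp [mul_comm]

lemma Nc_tr (hB : B.IsHermitian) (hR : IsUnit R) : (Nc B R * Nc B R).trace = (B * B).trace := by
  have h1 : Rᵀ * (R⁻¹)ᵀ = 1 := by
    rw [← transpose_mul, Matrix.nonsing_inv_mul _ ((Matrix.isUnit_iff_isUnit_det R).mp hR),
      transpose_one]
  unfold Nc
  calc _ = ((R⁻¹)ᵀ * (B * (Rᵀ * (R⁻¹)ᵀ) * B * Rᵀ)).trace := by simp only [Matrix.mul_assoc]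
    _ = ((B * B) * (Rᵀ * (R⁻¹)ᵀ)).trace := by
        rw [h1, Matrix.mul_one, trace_mul_comm]; simp only [Matrix.mul_assoc, h1]
    _ = _ := by rw [h1, Matrix.mul_one]

lemma Lc_der (hB : B.IsHermitian) (hR : IsUnit R) (τ : ℝ) (i j : Fin n) :
    HasDerivAt (fun τ => mfun (Mc B R τ) Real.log i j)
      (dmat (Mc B R τ) (Mc B R τ) (Mc B R τ * Nc B R) lam i j) τ :=
  hasDeriv_log (Mc_pos hB hR) (Mc_cont hB hR) (Mc_der hB hR τ) i j

lemma Gc_der (hB : B.IsHermitian) (hR : IsUnit R) (τ : ℝ) : HasDerivAt (Gc B R) (hc B R τ) τ := by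
  have : Gc B R = fun τ => ∑ i, ∑ j, mfun (Mc B R τ) Real.log i j * Nc B R j i := by
    funext τ; simp [Gc, Matrix.trace, Matrix.mul_apply]
  rw [this]
  have h2 : hc B R τ = ∑ i, ∑ j, dmat (Mc B R τ) (Mc B R τ) (Mc B R τ * Nc B R) lam i j *
      Nc B R j i := by simp [hc, Matrix.trace, Matrix.mul_apply]
  rw [h2]
  exact HasDerivAt.fun_sum fun i _ => HasDerivAt.fun_sum fun j _ =>
    (Lc_der hB hR τ i j).mul_const _

lemma yc_eq (hB : B.IsHermitian) (hR : IsUnit R) (τ : ℝ) : yc B R τ =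
    (mfun (Mc B R τ) Real.log * mfun (Mc B R τ) Real.log).trace := by
  rw [mfun_mul (Mc_pos hB hR τ).1, mfun_trace (Mc_pos hB hR τ).1]
  simp only [yc, sq]

lemma yc_der (hB : B.IsHermitian) (hR : IsUnit R) (τ : ℝ) : HasDerivAt (yc B R) (2 * Gc B R τ) τ := by
  have : yc B R = fun τ => ∑ i, ∑ j, mfun (Mc B R τ) Real.log i j *
      mfun (Mc B R τ) Real.log j i := by
    funext τ; rw [yc_eq hB hR]; simp [Matrix.trace, Matrix.mul_apply]
  rw [this]
  set L := mfun (Mc B R τ) Real.log with hL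
  set L' := dmat (Mc B R τ) (Mc B R τ) (Mc B R τ * Nc B R) lam with hL'
  have h2 : 2 * Gc B R τ = ∑ i, ∑ j, (L' i j * L j i + L i j * L' j i) := by
    rw [Gc, ← st_LD (Mc_pos hB hR τ), ← hL, ← hL', two_mul]
    simp only [Finset.sum_add_distrib]
    congr 1
    rw [trace_mul_comm]; simp [Matrix.trace, Matrix.mul_apply]
  rw [h2]
  exact HasDerivAt.fun_sum fun i _ => HasDerivAt.fun_sum fun j _ =>
    (Lc_der hB hR τ i j).mul (Lc_der hB hR τ j i)

lemma curve_lower (hB : B.IsHermitian) (hR : IsUnit R) : yc B R 0 + 2 * Gc B R 0 + (B * B).trace ≤ yc B R 1 := by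
  set b := (B * B).trace with hb
  have hh : ∀ τ, b ≤ hc B R τ := by
    intro τ
    have := st_lower (Mc_pos hB hR τ) (Mc_sym hB hR τ)
    rwa [Nc_tr hB hR] at this
  have h1 : ∀ t, 0 ≤ t → Gc B R 0 + b * t ≤ Gc B R t := by
    intro t ht
    have := antitone_of_deriv_le (g := fun t => b * t - Gc B R t) (g' := fun t => b - hc B R t)
      (fun t => by
        have := ((hasDerivAt_id t).const_mul b).sub (Gc_der hB hR t)
        refine this.congr_deriv ?_
        simp)
      (fun t _ => by linarith [hh t]) ht
    simp only [mul_zero] at this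
    linarith
  have := antitone_of_deriv_le (g := fun t => 2 * Gc B R 0 * t + b * t ^ 2 - yc B R t)
      (g' := fun t => 2 * Gc B R 0 + b * (2 * t) - 2 * Gc B R t)
      (fun t => by
        have := (((hasDerivAt_id t).const_mul (2 * Gc B R 0)).add
          ((hasDerivAt_pow 2 t).const_mul b)).sub (yc_der hB hR t)
        refine this.congr_deriv ?_
        simp)
      (fun t ht => by linarith [h1 t ht]) zero_le_one
  simp only [mul_zero, mul_one] at this
  norm_num at this
  linarith

lemma curve_min (hB : B.IsHermitian) (hR : IsUnit R) (h : ∀ θ ∈ Set.Icc (0:ℝ) 1, yc B R 0 ≤ yc B R θ) : 0 ≤ Gc B R 0 := by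
  have hd := (yc_der hB hR 0).hasDerivWithinAt (s := Set.Ioi 0)
  rw [hasDerivWithinAt_iff_tendsto_slope' (by simp)] at hd
  have : 0 ≤ 2 * Gc B R 0 := by
    refine ge_of_tendsto hd ?_
    filter_upwards [Ioo_mem_nhdsGT (zero_lt_one' ℝ)] with θ hθ
    rw [slope_def_field]
    exact div_nonneg (by linarith [h θ ⟨hθ.1.le, hθ.2.le⟩]) (by linarith [hθ.1])
  linarith

lemma curve_upper (hB : B.IsHermitian) (hR : IsUnit R) (hb : (B * B).trace = 1) {D t : ℝ} (hD : 0 < D) (ht : 0 < t)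
    (hy0 : yc B R 0 < D ^ 2) (hg : Gc B R 0 ≤ 0) :
    yc B R t ≤ yc B R 0 + (D * sinh (khat * t) / (t * tanh (khat * D))) * t ^ 2 +
      2 * t * Gc B R 0 := by
  have hk : 0 < khat := by unfold khat; positivity
  set κ := khat with hκ
  set δ := D ^ 2 - yc B R 0 with hδ
  have hδ0 : 0 < δ := by linarith
  have hyn : ∀ τ, 0 ≤ yc B R τ := fun τ => Finset.sum_nonneg fun _ _ => sq_nonneg _
  set E : ℝ → ℝ := fun τ => Real.sqrt (yc B R τ + δ) with hE
  have hEpos : ∀ τ, 0 < E τ := fun τ => Real.sqrt_pos.mpr (by linarith [hyn τ])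
  have hEsq : ∀ τ, E τ ^ 2 = yc B R τ + δ := fun τ => Real.sq_sqrt (by linarith [hyn τ])
  have hE0 : E 0 = D := by
    simp only [hE, hδ]; rw [add_sub_cancel]; exact Real.sqrt_sq hD.le
  have hEd : ∀ τ, HasDerivAt E (Gc B R τ / E τ) τ := by
    intro τ
    have := ((yc_der hB hR τ).add_const δ).sqrt (by linarith [hyn τ])
    refine this.congr_deriv ?_
    have := (hEpos τ).ne'
    simp only [hE] at this ⊢
    field_simp
  set P : ℝ → ℝ := fun τ => κ * sinh (κ * E τ) * (Gc B R τ / E τ) with hP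
  set P' : ℝ → ℝ := fun τ => κ * (cosh (κ * E τ) * (κ * (Gc B R τ / E τ))) * (Gc B R τ / E τ) +
    κ * sinh (κ * E τ) * ((hc B R τ * E τ - Gc B R τ * (Gc B R τ / E τ)) / E τ ^ 2) with hP'
  have hψd : ∀ τ, HasDerivAt (fun τ => cosh (κ * E τ)) (P τ) τ := by
    intro τ
    have := ((hEd τ).const_mul κ).cosh
    refine this.congr_deriv ?_
    simp only [hP]; ring
  have hPd : ∀ τ, HasDerivAt P (P' τ) τ := by
    intro τ
    exact ((((hEd τ).const_mul κ).sinh).const_mul κ).mul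
      ((Gc_der hB hR τ).div (hEd τ) (hEpos τ).ne')
  have hP'le : ∀ τ, P' τ ≤ κ ^ 2 * cosh (κ * E τ) := by
    intro τ
    have hu := st_upper (Mc_pos hB hR τ) (Mc_sym hB hR τ) (hEpos τ) rfl
      (by rw [hEsq]; change yc B R τ ≤ _; linarith)
    rw [Nc_tr hB hR, hb] at hu
    change hc B R τ ≤ Gc B R τ ^ 2 / E τ ^ 2 + κ * E τ * cosh (κ * E τ) / sinh (κ * E τ) *
      (1 - Gc B R τ ^ 2 / E τ ^ 2) at hu
    have hs : 0 < sinh (κ * E τ) := sinh_pos_iff.mpr (mul_pos hk (hEpos τ))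
    have hE1 := hEpos τ
    simp only [hP']
    generalize E τ = e at *
    generalize Gc B R τ = g at *
    generalize hc B R τ = h at *
    have e1 : κ * (cosh (κ * e) * (κ * (g / e))) * (g / e) +
        κ * sinh (κ * e) * ((h * e - g * (g / e)) / e ^ 2) =
        κ ^ 2 * cosh (κ * e) * (g ^ 2 / e ^ 2) +
        (κ * sinh (κ * e) / e) * (h - g ^ 2 / e ^ 2) := by
      field_simp
    have e2 : (κ * sinh (κ * e) / e) * (h - g ^ 2 / e ^ 2) ≤ (κ * sinh (κ * e) / e) *
        (κ * e * cosh (κ * e) / sinh (κ * e) * (1 - g ^ 2 / e ^ 2)) :=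
      mul_le_mul_of_nonneg_left (by linarith) (by positivity)
    have e3 : (κ * sinh (κ * e) / e) *
        (κ * e * cosh (κ * e) / sinh (κ * e) * (1 - g ^ 2 / e ^ 2)) =
        κ ^ 2 * cosh (κ * e) * (1 - g ^ 2 / e ^ 2) := by
      field_simp
    rw [e1]
    linarith
  have hch : ∀ τ, HasDerivAt (fun τ => cosh (κ * τ)) (κ * sinh (κ * τ)) τ := fun τ => by
    have := ((hasDerivAt_id τ).const_mul κ).cosh
    refine this.congr_deriv ?_
    simp [mul_comm]
  have hsh : ∀ τ, HasDerivAt (fun τ => sinh (κ * τ)) (κ * cosh (κ * τ)) τ := fun τ => by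
    have := ((hasDerivAt_id τ).const_mul κ).sinh
    refine this.congr_deriv ?_
    simp [mul_comm]
  have hode := ode_compare (κ := κ)
    (g := fun τ => cosh (κ * E τ) - (cosh (κ * D) * cosh (κ * τ) + P 0 / κ * sinh (κ * τ)))
    (g' := fun τ => P τ - (cosh (κ * D) * (κ * sinh (κ * τ)) + P 0 / κ * (κ * cosh (κ * τ))))
    (g'' := fun τ => P' τ - (cosh (κ * D) * (κ * (κ * cosh (κ * τ))) +
      P 0 / κ * (κ * (κ * sinh (κ * τ)))))
    (fun τ => (hψd τ).sub (((hch τ).const_mul _).add ((hsh τ).const_mul _)))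
    (fun τ => (hPd τ).sub ((((hsh τ).const_mul κ).const_mul _).add
      (((hch τ).const_mul κ).const_mul _)))
    (fun τ => by linarith [hP'le τ])
    (by simp [hE0])
    (by
      simp only [mul_zero, sinh_zero, cosh_zero, hE0]
      apply le_of_eq; field_simp; ring) ht.le
  have hP0 : P 0 / κ = sinh (κ * D) * (Gc B R 0 / D) := by
    simp only [hP, hE0]; field_simp
  rw [hP0] at hode
  have hsD : 0 < sinh (κ * D) := sinh_pos_iff.mpr (mul_pos hk hD)
  have hcD : 0 < cosh (κ * D) := cosh_pos _
  have htan := cosh_sq_tangent (x := κ * E t) (y := κ * D) (mul_nonneg hk.le (hEpos t).le)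
    (mul_pos hk hD)
  have hsq := hEsq t
  have h2c := two_cosh_sub (b := κ * t) (mul_nonneg hk.le ht.le)
  have hst : κ * t ≤ sinh (κ * t) := self_le_sinh_iff.mpr (mul_nonneg hk.le ht.le)
  rw [tanh_eq_sinh_div_cosh]
  generalize Gc B R 0 = g at *
  have hy : yc B R t = E t ^ 2 - D ^ 2 + yc B R 0 := by rw [hsq, hδ]; ring
  rw [hy]
  generalize E t = e at *
  generalize cosh (κ * e) = ce at *
  have hD' := hD.ne'
  have s1 : κ ^ 2 * (e ^ 2 - D ^ 2) * sinh (κ * D) ≤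
      2 * (κ * D) * (cosh (κ * D) * (cosh (κ * t) - 1) + sinh (κ * D) * (g / D) * sinh (κ * t)) := by
    have : 2 * (κ * D) * (ce - cosh (κ * D)) ≤ 2 * (κ * D) *
      (cosh (κ * D) * (cosh (κ * t) - 1) + sinh (κ * D) * (g / D) * sinh (κ * t)) :=
      mul_le_mul_of_nonneg_left (by linarith) (by positivity)
    linarith
  have s2 : 2 * (κ * D) * (cosh (κ * D) * (cosh (κ * t) - 1) +
      sinh (κ * D) * (g / D) * sinh (κ * t)) =
      κ * D * cosh (κ * D) * (2 * (cosh (κ * t) - 1)) +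
      2 * κ * sinh (κ * D) * (g * sinh (κ * t)) := by field_simp
  have s3 : κ * D * cosh (κ * D) * (2 * (cosh (κ * t) - 1)) ≤
      κ * D * cosh (κ * D) * (κ * t * sinh (κ * t)) :=
    mul_le_mul_of_nonneg_left h2c (by positivity)
  have s4 : 2 * κ * sinh (κ * D) * (g * sinh (κ * t)) ≤ 2 * κ * sinh (κ * D) * (g * (κ * t)) :=
    mul_le_mul_of_nonneg_left (mul_le_mul_of_nonpos_left hst hg) (by positivity)
  have s5 : κ ^ 2 * sinh (κ * D) * (e ^ 2 - D ^ 2) ≤ κ ^ 2 * sinh (κ * D) *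
      ((D * sinh (κ * t) / (t * (sinh (κ * D) / cosh (κ * D)))) * t ^ 2 + 2 * t * g) := by
    have : κ ^ 2 * sinh (κ * D) *
      ((D * sinh (κ * t) / (t * (sinh (κ * D) / cosh (κ * D)))) * t ^ 2 + 2 * t * g) =
      κ * D * cosh (κ * D) * (κ * t * sinh (κ * t)) + 2 * κ * sinh (κ * D) * (g * (κ * t)) := by
      field_simp
    rw [this]; linarith
  have := le_of_mul_le_mul_left s5 (by positivity)
  linarith

end dyn

end SPD

namespace SPD

variable {n : ℕ}

lemma mfun_comp {A : Matrix (Fin n) (Fin n) ℝ} (hA : A.IsHermitian) (f g : ℝ → ℝ) :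
    mfun (mfun A g) f = mfun A (fun x => f (g x)) := by
  have h := intertwine (X := 1) hA (mfun_herm A g) g (fun x => x) (fun x => f (g x)) f
    (fun j i e => by rw [e]) (by rw [mfun_id (mfun_herm A g)]; simp)
  simpa using h.symm

lemma mfun_const_mul {A : Matrix (Fin n) (Fin n) ℝ} (hA : A.IsHermitian) (t : ℝ) :
    mfun A (fun x => t * x) = t • A := by
  rw [mfun_eq hA]
  conv_rhs => rw [spec hA]
  have : diagonal (fun i => t * eigs A i) = t • diagonal (eigs A) := by
    rw [← diagonal_smul]; rfl
  rw [this]; simp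

lemma mfun_inv {A : Matrix (Fin n) (Fin n) ℝ} (hA : A.PosDef) :
    mfun A (fun x => x⁻¹) = A⁻¹ := by
  symm
  apply Matrix.inv_eq_right_inv
  have h := mfun_mul hA.1 (fun x => x) (fun x => x⁻¹)
  rw [mfun_id hA.1] at h
  rw [h, ← mfun_one hA.1]
  exact mfun_congr _ _ fun i => mul_inv_cancel₀ (eigs_pos hA i).ne'

lemma sS {p : Matrix (Fin n) (Fin n) ℝ} (hp : p.PosDef) : msqrt p * msqrt p = p := by
  rw [msqrt, mfun_mul hp.1]
  conv_rhs => rw [← mfun_id hp.1]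
  exact mfun_congr _ _ fun i => Real.mul_self_sqrt (eigs_pos hp i).le

lemma s_pos {p : Matrix (Fin n) (Fin n) ℝ} (hp : p.PosDef) : (msqrt p).PosDef :=
  mfun_posDef hp.1 fun i => Real.sqrt_pos.mpr (eigs_pos hp i)

lemma s_unit {p : Matrix (Fin n) (Fin n) ℝ} (hp : p.PosDef) : IsUnit (msqrt p) :=
  (s_pos hp).isUnit

lemma s_tr (p : Matrix (Fin n) (Fin n) ℝ) : (msqrt p)ᵀ = msqrt p := mfun_tr _ _

lemma t_tr (p : Matrix (Fin n) (Fin n) ℝ) : ((msqrt p)⁻¹)ᵀ = (msqrt p)⁻¹ := by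
  rw [transpose_nonsing_inv, s_tr]

lemma sT {p : Matrix (Fin n) (Fin n) ℝ} (hp : p.PosDef) : msqrt p * (msqrt p)⁻¹ = 1 :=
  Matrix.mul_nonsing_inv _ ((Matrix.isUnit_iff_isUnit_det _).mp (s_unit hp))

lemma tS {p : Matrix (Fin n) (Fin n) ℝ} (hp : p.PosDef) : (msqrt p)⁻¹ * msqrt p = 1 :=
  Matrix.nonsing_inv_mul _ ((Matrix.isUnit_iff_isUnit_det _).mp (s_unit hp))

lemma sT_mul {p : Matrix (Fin n) (Fin n) ℝ} (hp : p.PosDef) (Z : Matrix (Fin n) (Fin n) ℝ) :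
    msqrt p * ((msqrt p)⁻¹ * Z) = Z := by rw [← Matrix.mul_assoc, sT hp, Matrix.one_mul]

lemma tS_mul {p : Matrix (Fin n) (Fin n) ℝ} (hp : p.PosDef) (Z : Matrix (Fin n) (Fin n) ℝ) :
    (msqrt p)⁻¹ * (msqrt p * Z) = Z := by rw [← Matrix.mul_assoc, tS hp, Matrix.one_mul]

lemma t_unit {p : Matrix (Fin n) (Fin n) ℝ} (hp : p.PosDef) : IsUnit ((msqrt p)⁻¹) :=
  IsUnit.of_mul_eq_one _ (tS hp)

lemma pT {p : Matrix (Fin n) (Fin n) ℝ} (hp : p.PosDef) : p * (msqrt p)⁻¹ = msqrt p := by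
  have h := congrArg (fun Z => Z * (msqrt p)⁻¹) (sS hp)
  simp only [Matrix.mul_assoc, sT hp, Matrix.mul_one] at h
  exact h.symm

lemma pT_mul {p : Matrix (Fin n) (Fin n) ℝ} (hp : p.PosDef) (Z : Matrix (Fin n) (Fin n) ℝ) :
    p * ((msqrt p)⁻¹ * Z) = msqrt p * Z := by rw [← Matrix.mul_assoc, pT hp]

lemma p_inv {p : Matrix (Fin n) (Fin n) ℝ} (hp : p.PosDef) :
    p⁻¹ = (msqrt p)⁻¹ * (msqrt p)⁻¹ := by
  have h := congrArg (fun Z => Z⁻¹) (sS hp)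
  simpa [Matrix.mul_inv_rev] using h.symm

/-- the whitened matrix -/
noncomputable def tw (p u : Matrix (Fin n) (Fin n) ℝ) : Matrix (Fin n) (Fin n) ℝ :=
  (msqrt p)⁻¹ * u * (msqrt p)⁻¹

lemma tw_herm (p : Matrix (Fin n) (Fin n) ℝ) {u : Matrix (Fin n) (Fin n) ℝ}
    (hu : u.IsHermitian) : (tw p u).IsHermitian := by
  rw [herm_tr] at hu ⊢
  simp only [tw, transpose_mul, t_tr, hu, Matrix.mul_assoc]

lemma tw_pos {p q : Matrix (Fin n) (Fin n) ℝ} (hp : p.PosDef) (hq : q.PosDef) :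
    (tw p q).PosDef := by
  have := posDef_congr hq (t_unit hp)
  rwa [t_tr] at this

lemma s_sand {p W : Matrix (Fin n) (Fin n) ℝ} (hp : p.PosDef) (hW : W.PosDef) :
    (msqrt p * W * msqrt p).PosDef := by
  have := posDef_congr hW (s_unit hp)
  rwa [s_tr] at this

lemma minner_eq {p : Matrix (Fin n) (Fin n) ℝ} (hp : p.PosDef)
    (u v : Matrix (Fin n) (Fin n) ℝ) : minner p u v = (tw p u * tw p v).trace := by
  rw [minner, p_inv hp, tw, tw]
  have : (msqrt p)⁻¹ * (msqrt p)⁻¹ * u * ((msqrt p)⁻¹ * (msqrt p)⁻¹) * v =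
    (msqrt p)⁻¹ * ((msqrt p)⁻¹ * u * ((msqrt p)⁻¹ * (msqrt p)⁻¹) * v) := by
    simp only [Matrix.mul_assoc]
  rw [this, trace_mul_comm]
  simp only [Matrix.mul_assoc]

lemma tr_eq {A B : Matrix (Fin n) (Fin n) ℝ} (hB : B.IsHermitian) :
    (A * B).trace = ∑ x : Fin n × Fin n, A x.1 x.2 * B x.1 x.2 := by
  rw [Fintype.sum_prod_type]
  simp only [Matrix.trace, Matrix.diag, Matrix.mul_apply]
  refine Finset.sum_congr rfl fun i _ => Finset.sum_congr rfl fun j _ => ?_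
  rw [← congrFun (congrFun (herm_tr.mp hB) i) j, transpose_apply]

lemma tr_self {A : Matrix (Fin n) (Fin n) ℝ} (hA : A.IsHermitian) : 0 ≤ (A * A).trace := by
  rw [tr_eq hA]
  exact Finset.sum_nonneg fun _ _ => mul_self_nonneg _

lemma tr_self_pos {A : Matrix (Fin n) (Fin n) ℝ} (hA : A.IsHermitian) (h0 : A ≠ 0) :
    0 < (A * A).trace := by
  refine lt_of_le_of_ne (tr_self hA) fun h => h0 ?_
  rw [tr_eq hA, eq_comm, Finset.sum_eq_zero_iff_of_nonneg fun _ _ => mul_self_nonneg _] at h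
  ext i j
  exact mul_self_eq_zero.mp (h (i, j) (Finset.mem_univ _))

lemma tr_cs {A B : Matrix (Fin n) (Fin n) ℝ} (hA : A.IsHermitian) (hB : B.IsHermitian) :
    |(A * B).trace| ≤ √((A * A).trace) * √((B * B).trace) := by
  rw [← Real.sqrt_mul (tr_self hA)]
  apply Real.abs_le_sqrt
  rw [tr_eq hA, tr_eq hB, tr_eq hB]
  have := Finset.sum_mul_sq_le_sq_mul_sq Finset.univ
    (fun x : Fin n × Fin n => A x.1 x.2) (fun x => B x.1 x.2)
  simpa only [sq] using this

lemma mnorm_eq {p : Matrix (Fin n) (Fin n) ℝ} (hp : p.PosDef)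
    (u : Matrix (Fin n) (Fin n) ℝ) : mnorm p u = √((tw p u * tw p u).trace) := by
  rw [mnorm, minner_eq hp]

lemma tw_add (p u v : Matrix (Fin n) (Fin n) ℝ) : tw p (u + v) = tw p u + tw p v := by
  simp only [tw, Matrix.mul_add, Matrix.add_mul]

lemma tw_smul (p u : Matrix (Fin n) (Fin n) ℝ) (c : ℝ) : tw p (c • u) = c • tw p u := by
  simp [tw]

lemma tw_sand {p : Matrix (Fin n) (Fin n) ℝ} (hp : p.PosDef) (L : Matrix (Fin n) (Fin n) ℝ) :
    tw p (msqrt p * L * msqrt p) = L := by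
  simp only [tw, Matrix.mul_assoc, tS_mul hp, sT hp, Matrix.mul_one]

lemma sand_tw {p : Matrix (Fin n) (Fin n) ℝ} (hp : p.PosDef) (L : Matrix (Fin n) (Fin n) ℝ) :
    msqrt p * tw p L * msqrt p = L := by
  simp only [tw, Matrix.mul_assoc, sT_mul hp, tS hp, Matrix.mul_one]

lemma mnorm_add {p u v : Matrix (Fin n) (Fin n) ℝ} (hp : p.PosDef) (hu : u.IsHermitian)
    (hv : v.IsHermitian) : mnorm p (u + v) ≤ mnorm p u + mnorm p v := by
  rw [mnorm_eq hp, mnorm_eq hp, mnorm_eq hp, tw_add]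
  have hU := tw_herm p hu
  have hV := tw_herm p hv
  have h := (abs_le.mp (tr_cs hU hV)).2
  have h1 := Real.sq_sqrt (tr_self hU)
  have h2 := Real.sq_sqrt (tr_self hV)
  apply Real.sqrt_le_iff.mpr
  refine ⟨by positivity, ?_⟩
  rw [Matrix.mul_add, Matrix.add_mul, Matrix.add_mul, trace_add, trace_add, trace_add,
    trace_mul_comm (tw p v) (tw p u)]
  nlinarith

lemma mnorm_pos {p v : Matrix (Fin n) (Fin n) ℝ} (hp : p.PosDef) (hv : v.IsHermitian)
    (h0 : v ≠ 0) : 0 < mnorm p v := by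
  rw [mnorm_eq hp]
  apply Real.sqrt_pos.mpr (tr_self_pos (tw_herm p hv) _)
  intro h
  apply h0
  rw [← sand_tw hp v, h]; simp

lemma dR_nonneg (p q : Matrix (Fin n) (Fin n) ℝ) : 0 ≤ dR p q := Real.sqrt_nonneg _

lemma dR_sq (p q : Matrix (Fin n) (Fin n) ℝ) :
    dR p q ^ 2 = ∑ i, (Real.log (eigs (tw p q) i)) ^ 2 :=
  Real.sq_sqrt (Finset.sum_nonneg fun _ _ => sq_nonneg _)

lemma dR_sq_tr {p q : Matrix (Fin n) (Fin n) ℝ} (hp : p.PosDef) (hq : q.PosDef) :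
    dR p q ^ 2 = (mfun (tw p q) Real.log * mfun (tw p q) Real.log).trace := by
  rw [dR_sq, mfun_mul (tw_pos hp hq).1, mfun_trace (tw_pos hp hq).1]
  simp only [sq]

lemma minner_log_cs {p q u : Matrix (Fin n) (Fin n) ℝ} (hp : p.PosDef) (hq : q.PosDef)
    (hu : u.IsHermitian) : |minner p u (mlogP p q)| ≤ mnorm p u * dR p q := by
  have h := tr_cs (tw_herm p hu) (mfun_herm (tw p q) Real.log)
  rw [← dR_sq_tr hp hq, Real.sqrt_sq (dR_nonneg _ _), ← mnorm_eq hp] at h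
  rw [minner_eq hp, mlogP, tw_sand hp]
  exact h

lemma flip {p q : Matrix (Fin n) (Fin n) ℝ} (hp : p.PosDef) (hq : q.PosDef) (f g : ℝ → ℝ)
    (h : ∀ x, 0 < x → f x = g x⁻¹) :
    (msqrt p * (msqrt q)⁻¹) * mfun (tw q p) f = mfun (tw p q) g * (msqrt p * (msqrt q)⁻¹) := by
  apply intertwine (tw_pos hq hp).1 (tw_pos hp hq).1 (fun x => x⁻¹) (fun x => x) f g
  · intro j i e
    rw [h _ (eigs_pos (tw_pos hq hp) j), e]
  · rw [mfun_inv (tw_pos hq hp), mfun_id (tw_pos hp hq).1]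
    have : (tw q p)⁻¹ = msqrt q * (msqrt p)⁻¹ * (msqrt p)⁻¹ * msqrt q := by
      apply Matrix.inv_eq_right_inv
      rw [tw]
      simp only [Matrix.mul_assoc, tS_mul hq, pT_mul hp, sT_mul hp, tS hq]
    rw [this, tw]
    simp only [Matrix.mul_assoc, tS_mul hq, sT_mul hp, tS_mul hp, pT hq]

lemma flip_conj {p q : Matrix (Fin n) (Fin n) ℝ} (hp : p.PosDef) (hq : q.PosDef) (f g : ℝ → ℝ)
    (h : ∀ x, 0 < x → f x = g x⁻¹) :
    (msqrt p * (msqrt q)⁻¹) * mfun (tw q p) f * (msqrt q * (msqrt p)⁻¹) = mfun (tw p q) g := by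
  rw [flip hp hq f g h]
  simp only [Matrix.mul_assoc, tS_mul hq, sT hp, Matrix.mul_one]

lemma dR_comm {p q : Matrix (Fin n) (Fin n) ℝ} (hp : p.PosDef) (hq : q.PosDef) :
    dR p q = dR q p := by
  have h2 : dR p q ^ 2 = dR q p ^ 2 := by
    have h := congrArg Matrix.trace
      (flip_conj hp hq (fun x => Real.log x ^ 2) (fun x => Real.log x ^ 2)
        (fun x _ => by simp [Real.log_inv]))
    rw [trace_mul_comm] at h
    simp only [← Matrix.mul_assoc] at h
    rw [dR_sq, dR_sq, ← mfun_trace (tw_pos hp hq).1 (fun x => Real.log x ^ 2),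
      ← mfun_trace (tw_pos hq hp).1 (fun x => Real.log x ^ 2), ← h]
    simp only [Matrix.mul_assoc, tS_mul hp, sT_mul hq]
  have := congrArg Real.sqrt h2
  rwa [Real.sqrt_sq (dR_nonneg _ _), Real.sqrt_sq (dR_nonneg _ _)] at this

lemma R_tr (p q : Matrix (Fin n) (Fin n) ℝ) :
    ((msqrt q)⁻¹ * msqrt p)ᵀ = msqrt p * (msqrt q)⁻¹ := by
  rw [transpose_mul, s_tr, t_tr]

lemma R_unit {p q : Matrix (Fin n) (Fin n) ℝ} (hp : p.PosDef) (hq : q.PosDef) :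
    IsUnit ((msqrt q)⁻¹ * msqrt p) := (t_unit hq).mul (s_unit hp)

lemma R_inv_tr {p q : Matrix (Fin n) (Fin n) ℝ} (hp : p.PosDef) (hq : q.PosDef) :
    ((((msqrt q)⁻¹ * msqrt p))⁻¹)ᵀ = msqrt q * (msqrt p)⁻¹ := by
  rw [transpose_nonsing_inv, R_tr]
  apply Matrix.inv_eq_right_inv
  simp only [Matrix.mul_assoc, tS_mul hq, sT hp]

lemma dR_curve (p q B : Matrix (Fin n) (Fin n) ℝ) (τ : ℝ) :
    dR q (msqrt p * mfun B (fun x => Real.exp (τ * x)) * msqrt p) ^ 2 =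
      yc B ((msqrt q)⁻¹ * msqrt p) τ := by
  rw [dR_sq, yc, Mc, R_tr, tw]
  simp only [Matrix.mul_assoc]

lemma mfun_exp_zero {B : Matrix (Fin n) (Fin n) ℝ} (hB : B.IsHermitian) :
    mfun B (fun x => Real.exp (0 * x)) = 1 := by
  rw [← mfun_one hB]; simp

lemma dR_curve_zero {p q B : Matrix (Fin n) (Fin n) ℝ} (hp : p.PosDef) (hB : B.IsHermitian) :
    yc B ((msqrt q)⁻¹ * msqrt p) 0 = dR q p ^ 2 := by
  rw [← dR_curve, mfun_exp_zero hB, Matrix.mul_one, sS hp]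

lemma Gc_zero {p q B : Matrix (Fin n) (Fin n) ℝ} (hp : p.PosDef) (hq : q.PosDef)
    (hB : B.IsHermitian) :
    Gc B ((msqrt q)⁻¹ * msqrt p) 0 = -(mfun (tw p q) Real.log * B).trace := by
  have hM : Mc B ((msqrt q)⁻¹ * msqrt p) 0 = tw q p := by
    rw [Mc, R_tr, mfun_exp_zero hB, Matrix.mul_one, tw]
    have := congrArg (fun Z => (msqrt q)⁻¹ * Z * (msqrt q)⁻¹) (sS hp)
    simp only [Matrix.mul_assoc] at this ⊢
    exact this
  have h := flip_conj hp hq Real.log (fun x => (-1) * Real.log x)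
    (fun x _ => by simp [Real.log_inv])
  have h2 := mfun_comp (tw_pos hp hq).1 (fun x => (-1) * x) Real.log
  rw [mfun_const_mul (mfun_herm _ _)] at h2
  rw [← h2] at h
  have h3 : -(mfun (tw p q) Real.log * B).trace =
      (((-1 : ℝ) • mfun (tw p q) Real.log) * B).trace := by simp
  rw [h3, ← h, Gc, hM, Nc, R_inv_tr hp hq, R_tr]
  rw [← Matrix.mul_assoc, trace_mul_comm]
  simp only [Matrix.mul_assoc]

lemma gmean_eq {z q : Matrix (Fin n) (Fin n) ℝ} (hz : z.PosDef) (hq : q.PosDef) (θ : ℝ) :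
    gmean θ z q = msqrt z * mfun (mfun (tw z q) Real.log) (fun x => Real.exp (θ * x)) *
      msqrt z := by
  rw [mfun_comp (tw_pos hz hq).1, gmean]
  congr 2
  refine mfun_congr _ _ fun i => ?_
  have := eigs_pos (tw_pos hz hq) i
  change (eigs (tw z q) i) ^ θ = _
  rw [Real.rpow_def_of_pos this, mul_comm]
  rfl

lemma gmean_one {z q : Matrix (Fin n) (Fin n) ℝ} (hz : z.PosDef) (hq : q.PosDef) :
    gmean 1 z q = q := by
  have : mfun (tw z q) (fun x => x ^ (1:ℝ)) = tw z q := by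
    simp only [Real.rpow_one]
    exact mfun_id (tw_pos hz hq).1
  rw [gmean]
  change msqrt z * mfun (tw z q) (fun x => x ^ (1:ℝ)) * msqrt z = q
  rw [this, sand_tw hz]

lemma proj_ineq {Q z q : Matrix (Fin n) (Fin n) ℝ} (hQ : Q.PosDef) (hz : z.PosDef)
    (hq : q.PosDef) (h : ∀ θ ∈ Set.Icc (0:ℝ) 1, dR Q z ≤ dR Q (gmean θ z q)) :
    dR z q ^ 2 ≤ dR Q q ^ 2 := by
  set B := mfun (tw z q) Real.log with hBdef
  have hB : B.IsHermitian := mfun_herm _ _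
  have hR := R_unit hz hQ
  have hy : ∀ θ, yc B ((msqrt Q)⁻¹ * msqrt z) θ = dR Q (gmean θ z q) ^ 2 := fun θ => by
    rw [gmean_eq hz hq, ← dR_curve]
  have h0 := dR_curve_zero (q := Q) hz hB
  have hg := curve_min hB hR (fun θ hθ => by
    rw [h0, hy]
    exact pow_le_pow_left₀ (dR_nonneg _ _) (h θ hθ) 2)
  have hl := curve_lower hB hR
  rw [hy 1, gmean_one hz hq, h0, ← dR_sq_tr hz hq] at hl
  nlinarith [sq_nonneg (dR Q z)]

lemma exp_curve {p v : Matrix (Fin n) (Fin n) ℝ} (hv : v.IsHermitian) (t m : ℝ) :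
    mexpP p (-(t / m) • v) = msqrt p * mfun ((-(1 / m)) • tw p v) (fun x => Real.exp (t * x)) *
      msqrt p := by
  have hB : ((-(1 / m)) • tw p v).IsHermitian := by
    have := tw_herm p hv
    rw [herm_tr] at this ⊢
    rw [transpose_smul, this]
  have h := mfun_comp hB Real.exp (fun x => t * x)
  rw [mfun_const_mul hB] at h
  rw [← h, mexpP]
  change msqrt p * mfun (tw p (-(t / m) • v)) _ * _ = _
  rw [tw_smul, smul_smul]
  congr 4
  ring

lemma exp_pos_def {p v : Matrix (Fin n) (Fin n) ℝ} (hp : p.PosDef) (hv : v.IsHermitian) (c : ℝ) :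
    (mexpP p (c • v)).PosDef := by
  rw [mexpP]
  apply s_sand hp
  refine mfun_posDef ?_ fun i => Real.exp_pos _
  apply tw_herm
  rw [herm_tr] at hv ⊢
  rw [transpose_smul, hv]

lemma step_ineq {p q v : Matrix (Fin n) (Fin n) ℝ} (hp : p.PosDef) (hq : q.PosDef)
    (hv : v.IsHermitian) (hv0 : v ≠ 0) {t D : ℝ} (ht : 0 < t) (hD : 0 < D) (hd : dR q p < D)
    (hm : minner p v (mlogP p q) ≤ 0) :
    dR q (mexpP p (-(t / mnorm p v) • v)) ^ 2 ≤ dR q p ^ 2 +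
      (D * sinh (khat * t) / (t * tanh (khat * D))) * t ^ 2 +
      2 * t * (minner p v (mlogP p q) / mnorm p v) := by
  have hmp := mnorm_pos hp hv hv0
  have hm2 : mnorm p v ^ 2 = (tw p v * tw p v).trace := by
    rw [mnorm_eq hp, Real.sq_sqrt (tr_self (tw_herm p hv))]
  set m := mnorm p v with hmdef
  rw [exp_curve hv, dR_curve]
  set B := (-(1 / m)) • tw p v with hBdef
  have hB : B.IsHermitian := by
    have := tw_herm p hv
    rw [herm_tr] at this ⊢
    rw [hBdef, transpose_smul, this]
  have hb : (B * B).trace = 1 := by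
    rw [hBdef, Matrix.smul_mul, Matrix.mul_smul, trace_smul, trace_smul, ← hm2, smul_eq_mul,
      smul_eq_mul]
    field_simp
  have hG : Gc B ((msqrt q)⁻¹ * msqrt p) 0 = minner p v (mlogP p q) / m := by
    rw [Gc_zero hp hq hB, minner_eq hp, mlogP, tw_sand hp, hBdef, Matrix.mul_smul, trace_smul,
      trace_mul_comm]
    change -(-(1 / m) • (tw p v * mfun (tw p q) Real.log).trace) =
      (tw p v * mfun (tw p q) Real.log).trace / m
    rw [smul_eq_mul]; ring
  have h := curve_upper hB (R_unit hp hq) hb hD ht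
    (by rw [dR_curve_zero hp hB]; exact pow_lt_pow_left₀ hd (dR_nonneg _ _) two_ne_zero)
    (by rw [hG]; exact div_nonpos_of_nonpos_of_nonneg hm hmp.le)
  rwa [dR_curve_zero hp hB, hG] at h

end SPD

open SPD

/-- Complexity bound for the inexact projected subgradient method with
constant step size `t̄`, with `κ̂ = 1/√2` and `ζ = D·sinh(κ̂t̄)/(t̄·tanh(κ̂D))`. -/
theorem complexity_constant {n : ℕ}
    (f : Matrix (Fin n) (Fin n) ℝ → ℝ) (hf : GConvexFun f)
    (X : Set (Matrix (Fin n) (Fin n) ℝ)) (hXpos : ∀ x ∈ X, x.PosDef)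
    (hXne : X.Nonempty) (hXcpt : IsCompact X) (hXconv : GConvexSet X)
    (D : ℝ) (hD : 0 < D) (hdiam : ∀ p ∈ X, ∀ q ∈ X, dR p q < D)
    (p s u : ℕ → Matrix (Fin n) (Fin n) ℝ) (tbar : ℝ) (htbar : 0 < tbar)
    (hit : Iter f X p s u (fun _ => tbar))
    (ε ι : ℝ) (hε : 0 < ε) (hι : 0 < ι) (N : ℕ) (hN : 0 < N)
    (hu : ∀ k < N, mnorm (p k) (u k) ≤ ε) (hs : ∀ k < N, mnorm (p k) (s k) ≤ ι) :
    (Finset.range N).inf' (Finset.nonempty_range_iff.mpr (by omega))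
        (fun k => f (p k) - (sInf (f '' X) + ε * D))
      ≤ (ε + ι) *
          ((D ^ 2 + (D * Real.sinh (khat * tbar) / (tbar * Real.tanh (khat * D)))
                * N * tbar ^ 2)
            / (2 * N * tbar)) := by
  have hpX : ∀ k, p k ∈ X := fun k => by
    cases k with
    | zero => exact hit.p0_mem
    | succ k => exact hit.proj_mem k
  have hNpos : (0:ℝ) < N := by exact_mod_cast hN
  have hkh : 0 < khat := by unfold khat; positivity
  have hζ : 0 < D * Real.sinh (khat * tbar) / (tbar * Real.tanh (khat * D)) := by
    rw [Real.tanh_eq_sinh_div_cosh]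
    have h1 : 0 < Real.sinh (khat * tbar) := Real.sinh_pos_iff.mpr (mul_pos hkh htbar)
    have h2 : 0 < Real.sinh (khat * D) := Real.sinh_pos_iff.mpr (mul_pos hkh hD)
    have h3 : 0 < Real.cosh (khat * D) := Real.cosh_pos _
    positivity
  have hstep : ∀ q ∈ X, ∀ k < N, 0 ≤ f (p k) - f q - ε * D →
      dR q (p (k + 1)) ^ 2 ≤ dR q (p k) ^ 2 +
        (D * Real.sinh (khat * tbar) / (tbar * Real.tanh (khat * D))) * tbar ^ 2 -
        2 * tbar * ((f (p k) - f q - ε * D) / (ε + ι)) := by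
    intro q hqX k hk hΔ
    have hp := hXpos _ (hpX k)
    have hq := hXpos _ hqX
    have hz := hXpos _ (hpX (k + 1))
    obtain ⟨hsH, hsg⟩ := hit.subgrad k
    have huH := hit.u_herm k
    have hvH : (s k + u k).IsHermitian := hsH.add huH
    have hv0 := hit.v_ne k
    have hm := mnorm_pos hp hvH hv0
    have hml : mnorm (p k) (s k + u k) ≤ ε + ι := by
      linarith [mnorm_add hp hsH huH, hu k hk, hs k hk]
    have hin : minner (p k) (s k + u k) (mlogP (p k) q) ≤ -(f (p k) - f q - ε * D) := by
      have h1 := hsg q hq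
      have h2 := (abs_le.mp (minner_log_cs hp hq huH)).2
      have h3 : mnorm (p k) (u k) * dR (p k) q ≤ ε * D :=
        mul_le_mul (hu k hk) (hdiam _ (hpX k) _ hqX).le (dR_nonneg _ _) hε.le
      have h4 : minner (p k) (s k + u k) (mlogP (p k) q) =
          minner (p k) (s k) (mlogP (p k) q) + minner (p k) (u k) (mlogP (p k) q) := by
        simp only [minner, Matrix.mul_add, Matrix.add_mul, Matrix.trace_add]
      linarith
    have hst := step_ineq hp hq hvH hv0 htbar hD (hdiam _ hqX _ (hpX k)) (by linarith)
    have hQ := exp_pos_def hp hvH (-(tbar / mnorm (p k) (s k + u k)))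
    have hpr := proj_ineq hQ hz hq (fun θ hθ =>
      hit.proj_nearest k _ (hXconv _ (hpX (k + 1)) _ hqX θ hθ))
    rw [dR_comm hz hq, dR_comm hQ hq] at hpr
    have hdiv : minner (p k) (s k + u k) (mlogP (p k) q) / mnorm (p k) (s k + u k) ≤
        -((f (p k) - f q - ε * D) / (ε + ι)) := by
      have h1 : (f (p k) - f q - ε * D) / (ε + ι) ≤
          (f (p k) - f q - ε * D) / mnorm (p k) (s k + u k) :=
        div_le_div_of_nonneg_left hΔ hm hml
      have h2 : minner (p k) (s k + u k) (mlogP (p k) q) / mnorm (p k) (s k + u k) ≤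
          -(f (p k) - f q - ε * D) / mnorm (p k) (s k + u k) :=
        div_le_div_of_nonneg_right hin hm.le
      rw [neg_div] at h2
      linarith
    have := mul_le_mul_of_nonneg_left hdiv (by positivity : (0:ℝ) ≤ 2 * tbar)
    linarith
  generalize D * Real.sinh (khat * tbar) / (tbar * Real.tanh (khat * D)) = ζ at *
  set K := (ε + ι) * ((D ^ 2 + ζ * N * tbar ^ 2) / (2 * N * tbar)) with hK
  have hKpos : 0 < K := by positivity
  have hmin : ∀ q ∈ X, ∃ k < N, f (p k) - f q - ε * D ≤ K := by
    intro q hq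
    by_contra! hcon
    have hc : 0 < ε + ι := by linarith
    have hind : ∀ k ≤ N, dR q (p k) ^ 2 ≤ dR q (p 0) ^ 2 +
        k * (ζ * tbar ^ 2 - 2 * tbar * (K / (ε + ι))) := by
      intro k
      induction k with
      | zero => intro _; simp
      | succ k ih =>
        intro hk
        have h1 := ih (by omega)
        have h2 := hcon k (by omega)
        have h3 := hstep q hq k (by omega) (by linarith)
        have h4 : K / (ε + ι) ≤ (f (p k) - f q - ε * D) / (ε + ι) :=
          div_le_div_of_nonneg_right h2.le hc.le
        have h5 := mul_le_mul_of_nonneg_left h4 (by positivity : (0:ℝ) ≤ 2 * tbar)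
        push_cast
        linarith
    have h1 := hind N le_rfl
    have h2 : (N:ℝ) * (ζ * tbar ^ 2 - 2 * tbar * (K / (ε + ι))) = -D ^ 2 := by
      rw [hK]; field_simp; ring
    have h3 : dR q (p 0) ^ 2 < D ^ 2 :=
      pow_lt_pow_left₀ (hdiam _ hq _ (hpX 0)) (dR_nonneg _ _) two_ne_zero
    rw [h2] at h1
    linarith [sq_nonneg (dR q (p N))]
  obtain ⟨k0, hk0, hk0min⟩ := Finset.exists_min_image (Finset.range N) (fun k => f (p k))
    (Finset.nonempty_range_iff.mpr (by omega))
  have hlow : f (p k0) - ε * D - K ≤ sInf (f '' X) := by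
    apply le_csInf (hXne.image f)
    rintro _ ⟨q, hq, rfl⟩
    obtain ⟨k, hk, hle⟩ := hmin q hq
    have := hk0min k (Finset.mem_range.mpr hk)
    linarith
  refine (Finset.inf'_le _ hk0).trans ?_
  linarith
end
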